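/- arXiv:1711.08986 — 2 statements merged into one kernel-verified Lean document; each statement's English description precedes it below -/
import Mathlib

section
/- For every signed excursion (g,s), the support of the permuton μ_{g,s} = (Id, φ_{g,s})_* Leb has Hausdorff dimension exactly 1, and its 1-dimensional Hausdorff measure is at most √2. -/
open MeasureTheory Set

noncomputable section

/-- `x` is not a one-sided minimum of `g`. -/
def NotOneSidedMin (g : ℝ → ℝ) (x : ℝ) : Prop :=
  x ∈ Set.Ioo (0:ℝ) 1 ∧ ∀ ε > 0, (∃ x₁ ∈ Set.Ioo (x-ε) x, g x₁ < g x) ∧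
    (∃ x₂ ∈ Set.Ioo x (x+ε), g x₂ < g x)

/-- `b` is an inner local minimum of `g`. -/
def IsInnerLocalMin (g : ℝ → ℝ) (b : ℝ) : Prop :=
  b ∈ Set.Ioo (0:ℝ) 1 ∧ ∃ ε > 0, ∀ x ∈ Set.Ioo (b-ε) (b+ε), g b ≤ g x

/-- `b` is a strict (inner) local minimum of `g`. -/
def IsStrictLocalMin (g : ℝ → ℝ) (b : ℝ) : Prop :=
  b ∈ Set.Ioo (0:ℝ) 1 ∧ ∃ ε > 0, ∀ x ∈ Set.Ioo (b-ε) (b+ε), x ≠ b → g b < g x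

/-- A CRT excursion. -/
structure IsCRT (g : ℝ → ℝ) : Prop where
  cont : ContinuousOn g (Set.Icc 0 1)
  nonneg : ∀ t ∈ Set.Icc (0:ℝ) 1, 0 ≤ g t
  pos : ∀ t ∈ Set.Ioo (0:ℝ) 1, 0 < g t
  zero0 : g 0 = 0
  zero1 : g 1 = 0
  dense_min : ∀ x ∈ Set.Icc (0:ℝ) 1, x ∈ closure {b | IsInnerLocalMin g b}
  distinct : ∀ b b', IsInnerLocalMin g b → IsInnerLocalMin g b' → g b = g b' → b = b'
  leaves_full : volume {x | NotOneSidedMin g x} = 1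

/-- `β` is the unique minimum point of `g` on `[x,y]`, lies in `(x,y)`,
and is a strict local minimum: the most recent common ancestor of `x < y`. -/
def IsMrca (g : ℝ → ℝ) (β x y : ℝ) : Prop :=
  x < y ∧ β ∈ Set.Ioo x y ∧ IsStrictLocalMin g β ∧
    (∀ t ∈ Set.Icc x y, g β ≤ g t) ∧ (∀ t ∈ Set.Icc x y, g t = g β → t = β)

/-- `x` and `y` are `g`-comparable. -/
def GComparable (g : ℝ → ℝ) (x y : ℝ) : Prop :=
  ∃ β, IsMrca g β (min x y) (max x y)

/-- `b` enumerates (injectively) the strict local minima of `g`. -/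
def IsEnum (g : ℝ → ℝ) (b : ℕ → ℝ) : Prop :=
  Function.Injective b ∧ ∀ β, IsStrictLocalMin g β ↔ ∃ i, b i = β

/-- The sign-shuffled comparison relation `u ⊲ v` : if the mrca of `u,v` carries
sign `⊕` (`true`) then the smaller goes first, otherwise the bigger goes first. -/
def Tri (g : ℝ → ℝ) (b : ℕ → ℝ) (s : ℕ → Bool) (u v : ℝ) : Prop :=
  ∃ i, (IsMrca g (b i) u v ∧ s i = true) ∨ (IsMrca g (b i) v u ∧ s i = false)

/-- The measure-preserving function `φ_{g,s}`. -/
def phi (g : ℝ → ℝ) (b : ℕ → ℝ) (s : ℕ → Bool) (t : ℝ) : ℝ :=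
  (volume {u ∈ Set.Icc (0:ℝ) 1 | Tri g b s u t}).toReal

def aPt (g : ℝ → ℝ) (β : ℝ) : ℝ := sSup {t | t < β ∧ g t = g β}
def cPt (g : ℝ → ℝ) (β : ℝ) : ℝ := sInf {t | β < t ∧ g t = g β}

def aI (g : ℝ → ℝ) (b : ℕ → ℝ) (i : ℕ) : ℝ := aPt g (b i)
def cI (g : ℝ → ℝ) (b : ℕ → ℝ) (i : ℕ) : ℝ := cPt g (b i)
def aI' (g : ℝ → ℝ) (b : ℕ → ℝ) (s : ℕ → Bool) (i : ℕ) : ℝ := phi g b s (aI g b i)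
def cI' (g : ℝ → ℝ) (b : ℕ → ℝ) (s : ℕ → Bool) (i : ℕ) : ℝ :=
  aI' g b s i + (cI g b i - aI g b i)
def bI' (g : ℝ → ℝ) (b : ℕ → ℝ) (s : ℕ → Bool) (i : ℕ) : ℝ :=
  aI' g b s i + (if s i then b i - aI g b i else cI g b i - b i)

/-- The permuton `μ_{g,s} = (Id, φ_{g,s})_* Leb`. -/
def permuton (g : ℝ → ℝ) (b : ℕ → ℝ) (s : ℕ → Bool) : Measure (ℝ × ℝ) :=
  Measure.map (fun t => (t, phi g b s t)) (volume.restrict (Set.Icc 0 1))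

/-- Property (A) of a signed excursion. -/
def PropA (g : ℝ → ℝ) (b : ℕ → ℝ) (s : ℕ → Bool) : Prop :=
  ∀ i j, i ≠ j →
    Set.Icc (aI' g b s j) (cI' g b s j) ⊆ Set.Icc (aI' g b s i) (cI' g b s i) →
    (∀ y ∈ Set.Icc (g (b i)) (g (b j)),
      y ∈ closure {h | ∃ l, h = g (b l) ∧
        Set.Icc (aI' g b s l) (cI' g b s l) ⊆ Set.Icc (aI' g b s i) (cI' g b s i) ∧
        Set.Icc (aI' g b s j) (cI' g b s j) ⊆ Set.Icc (bI' g b s l) (cI' g b s l)}) ∧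
    (∀ y ∈ Set.Icc (g (b i)) (g (b j)),
      y ∈ closure {h | ∃ l, h = g (b l) ∧
        Set.Icc (aI' g b s l) (cI' g b s l) ⊆ Set.Icc (aI' g b s i) (cI' g b s i) ∧
        Set.Icc (aI' g b s j) (cI' g b s j) ⊆ Set.Icc (aI' g b s l) (bI' g b s l)})

/-- The shuffled excursion `f_{g,s}`. -/
def fShuffle (g : ℝ → ℝ) (b : ℕ → ℝ) (s : ℕ → Bool) (t : ℝ) : ℝ :=
  ⨆ i, Set.indicator (Set.Icc (aI' g b s i) (cI' g b s i)) (fun _ => g (b i)) t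

/-- Topological support of a measure. -/
def mSupport {α : Type*} [TopologicalSpace α] [MeasurableSpace α] (μ : Measure α) : Set α :=
  {x | ∀ U : Set α, IsOpen U → x ∈ U → μ U ≠ 0}

/-- The support of the permuton, viewed in the Euclidean plane. -/
def permutonE (g : ℝ → ℝ) (b : ℕ → ℝ) (s : ℕ → Bool) : Measure (EuclideanSpace ℝ (Fin 2)) :=
  Measure.map (fun t => (WithLp.equiv 2 (Fin 2 → ℝ)).symm ![t, phi g b s t])
    (volume.restrict (Set.Icc 0 1))

/-- The connected component of `{g > h}` in `[0,1]` that contains `p` (empty if `g p ≤ h`). -/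
def excSet (g : ℝ → ℝ) (p h : ℝ) : Set ℝ :=
  {u | u ∈ Icc (0:ℝ) 1 ∧ ∀ v ∈ uIcc u p, h < g v}

/-- Lebesgue measure on the unit interval. -/
abbrev lebI : Measure ℝ := volume.restrict (Icc 0 1)

lemma uIcc_subset_uIcc_union {u w z p : ℝ} (hz : z ∈ Icc u w) :
    uIcc z p ⊆ uIcc u p ∪ uIcc w p := by
  intro v hv
  simp only [mem_union, mem_uIcc, mem_Icc] at *
  grind

lemma excSet_ordConnected (g : ℝ → ℝ) (p h : ℝ) : (excSet g p h).OrdConnected := by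
  refine ⟨fun u hu w hw z hz => ⟨⟨hu.1.1.trans hz.1, hz.2.trans hw.1.2⟩, fun v hv => ?_⟩⟩
  rcases uIcc_subset_uIcc_union hz hv with h' | h'
  · exact hu.2 v h'
  · exact hw.2 v h'

lemma measurableSet_excSet (g : ℝ → ℝ) (p h : ℝ) : MeasurableSet (excSet g p h) :=
  (excSet_ordConnected g p h).measurableSet

lemma excSet_antitone (g : ℝ → ℝ) (p : ℝ) : Antitone (excSet g p) :=
  fun _ _ hk _ hu => ⟨hu.1, fun v hv => hk.trans_lt (hu.2 v hv)⟩

lemma uIcc_subset_union (u p z : ℝ) : uIcc u z ⊆ uIcc u p ∪ uIcc p z := by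
  intro v hv
  simp only [mem_union, mem_uIcc] at *
  grind

lemma excSet_subset_of_mem {g : ℝ → ℝ} {p q h : ℝ} (hq : q ∈ excSet g p h) :
    excSet g q h ⊆ excSet g p h := by
  refine fun u hu => ⟨hu.1, fun v hv => ?_⟩
  rcases uIcc_subset_union u q p hv with h' | h'
  · exact hu.2 v h'
  · exact hq.2 v h'

lemma mem_excSet_symm {g : ℝ → ℝ} {p q h : ℝ} (hp : p ∈ Icc (0:ℝ) 1) (hq : q ∈ excSet g p h) :
    p ∈ excSet g q h :=
  ⟨hp, fun v hv => hq.2 v (uIcc_comm p q ▸ hv)⟩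

lemma excSet_eq_of_mem {g : ℝ → ℝ} {p q h : ℝ} (hp : p ∈ Icc (0:ℝ) 1) (hq : q ∈ excSet g p h) :
    excSet g q h = excSet g p h :=
  (excSet_subset_of_mem hq).antisymm (excSet_subset_of_mem (mem_excSet_symm hp hq))

lemma isMrca_left_of_isMrca {g : ℝ → ℝ} {β u p t h : ℝ} (hup : ∀ v ∈ uIcc u p, h < g v)
    (hpt : ∃ v ∈ uIcc p t, g v ≤ h) (hm : IsMrca g β u t) : IsMrca g β p t := by
  obtain ⟨v, hv, hvh⟩ := hpt
  obtain ⟨hut, hβ, hs, hmin, huni⟩ := hm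
  have hv' : v ∉ uIcc u p := fun h' => (hup v h').not_ge hvh
  simp only [mem_uIcc, mem_Icc, mem_Ioo] at *
  have h1 : p < t := by grind
  have h2 : v ∈ Icc u t := by simp only [mem_Icc]; grind
  have h3 : g β ≤ h := (hmin v h2).trans hvh
  have h4 : ¬ (u ≤ β ∧ β ≤ p ∨ p ≤ β ∧ β ≤ u) := fun h' => (hup β h').not_ge h3
  refine ⟨h1, by simp only [mem_Ioo]; grind, hs, fun w hw => ?_, fun w hw hwe => ?_⟩
  · by_cases hc : u ≤ w
    · exact hmin w ⟨hc, hw.2⟩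
    · exact (h3.trans_lt (hup w (Or.inr ⟨hw.1, by linarith⟩))).le
  · by_cases hc : u ≤ w
    · exact huni w ⟨hc, hw.2⟩ hwe
    · exact absurd (hup w (Or.inr ⟨hw.1, by linarith⟩)) (by linarith)

lemma isMrca_right_of_isMrca {g : ℝ → ℝ} {β u p t h : ℝ} (hup : ∀ v ∈ uIcc u p, h < g v)
    (hpt : ∃ v ∈ uIcc p t, g v ≤ h) (hm : IsMrca g β t u) : IsMrca g β t p := by
  obtain ⟨v, hv, hvh⟩ := hpt
  obtain ⟨hut, hβ, hs, hmin, huni⟩ := hm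
  have hv' : v ∉ uIcc u p := fun h' => (hup v h').not_ge hvh
  simp only [mem_uIcc, mem_Icc, mem_Ioo] at *
  have h1 : t < p := by grind
  have h2 : v ∈ Icc t u := by simp only [mem_Icc]; grind
  have h3 : g β ≤ h := (hmin v h2).trans hvh
  have h4 : ¬ (u ≤ β ∧ β ≤ p ∨ p ≤ β ∧ β ≤ u) := fun h' => (hup β h').not_ge h3
  refine ⟨h1, by simp only [mem_Ioo]; grind, hs, fun w hw => ?_, fun w hw hwe => ?_⟩
  · by_cases hc : w ≤ u
    · exact hmin w ⟨hw.1, hc⟩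
    · exact (h3.trans_lt (hup w (Or.inl ⟨by linarith, hw.2⟩))).le
  · by_cases hc : w ≤ u
    · exact huni w ⟨hw.1, hc⟩ hwe
    · exact absurd (hup w (Or.inl ⟨by linarith, hw.2⟩)) (by linarith)

lemma exists_le_of_notMem_excSet {g : ℝ → ℝ} {p t h : ℝ} (ht : t ∈ Icc (0:ℝ) 1)
    (htn : t ∉ excSet g p h) : ∃ v ∈ uIcc p t, g v ≤ h := by
  by_contra! hc
  exact htn ⟨ht, fun v hv => hc v (uIcc_comm t p ▸ hv)⟩

section Tri

variable {g : ℝ → ℝ} {b : ℕ → ℝ} {s : ℕ → Bool} {p u t h : ℝ}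

lemma tri_left_imp (hu : u ∈ excSet g p h) (ht : t ∈ Icc (0:ℝ) 1)
    (htn : t ∉ excSet g p h) (hT : Tri g b s u t) : Tri g b s p t := by
  obtain ⟨i, hi⟩ := hT
  have hv := exists_le_of_notMem_excSet ht htn
  exact ⟨i, hi.imp (fun h' => ⟨isMrca_left_of_isMrca hu.2 hv h'.1, h'.2⟩)
    (fun h' => ⟨isMrca_right_of_isMrca hu.2 hv h'.1, h'.2⟩)⟩

lemma tri_right_imp (hu : u ∈ excSet g p h) (ht : t ∈ Icc (0:ℝ) 1)
    (htn : t ∉ excSet g p h) (hT : Tri g b s t u) : Tri g b s t p := by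
  obtain ⟨i, hi⟩ := hT
  have hv := exists_le_of_notMem_excSet ht htn
  exact ⟨i, hi.imp (fun h' => ⟨isMrca_right_of_isMrca hu.2 hv h'.1, h'.2⟩)
    (fun h' => ⟨isMrca_left_of_isMrca hu.2 hv h'.1, h'.2⟩)⟩

/-- All points of an excursion interval compare in the same way with a point outside. -/
lemma tri_left_iff (hp : p ∈ Icc (0:ℝ) 1) (hu : u ∈ excSet g p h) (ht : t ∈ Icc (0:ℝ) 1)
    (htn : t ∉ excSet g p h) : Tri g b s u t ↔ Tri g b s p t := by
  refine ⟨tri_left_imp hu ht htn, fun hT => ?_⟩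
  have he := excSet_eq_of_mem hp hu
  exact tri_left_imp (mem_excSet_symm hp hu) ht (he ▸ htn) hT

lemma tri_right_iff (hp : p ∈ Icc (0:ℝ) 1) (hu : u ∈ excSet g p h) (ht : t ∈ Icc (0:ℝ) 1)
    (htn : t ∉ excSet g p h) : Tri g b s t u ↔ Tri g b s t p := by
  refine ⟨tri_right_imp hu ht htn, fun hT => ?_⟩
  have he := excSet_eq_of_mem hp hu
  exact tri_right_imp (mem_excSet_symm hp hu) ht (he ▸ htn) hT

end Tri

lemma isMrca_iff (g : ℝ → ℝ) (β x y : ℝ) : IsMrca g β x y ↔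
    IsStrictLocalMin g β ∧ (x < β ∧ ∀ v ∈ Icc x β, v ≠ β → g β < g v) ∧
      (β < y ∧ ∀ v ∈ Icc β y, v ≠ β → g β < g v) := by
  constructor
  · rintro ⟨hxy, hβ, hs, hmin, huni⟩
    refine ⟨hs, ⟨hβ.1, fun v hv hne => ?_⟩, ⟨hβ.2, fun v hv hne => ?_⟩⟩
    · have hv' : v ∈ Icc x y := ⟨hv.1, hv.2.trans hβ.2.le⟩
      exact lt_of_le_of_ne (hmin v hv') fun h => hne (huni v hv' h.symm)
    · have hv' : v ∈ Icc x y := ⟨hβ.1.le.trans hv.1, hv.2⟩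
      exact lt_of_le_of_ne (hmin v hv') fun h => hne (huni v hv' h.symm)
  · rintro ⟨hs, ⟨h1, h2⟩, h3, h4⟩
    have key : ∀ v ∈ Icc x y, v ≠ β → g β < g v := fun v hv hne => by
      rcases le_total v β with h | h
      · exact h2 v ⟨hv.1, h⟩ hne
      · exact h4 v ⟨h, hv.2⟩ hne
    refine ⟨h1.trans h3, ⟨h1, h3⟩, hs, fun v hv => ?_, fun v hv he => ?_⟩
    · rcases eq_or_ne v β with rfl | hne
      · exact le_rfl
      · exact (key v hv hne).le
    · by_contra hne
      exact (key v hv hne).ne he.symm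

lemma measurableSet_isMrca (g : ℝ → ℝ) (β : ℝ) :
    MeasurableSet {z : ℝ × ℝ | IsMrca g β z.1 z.2} := by
  by_cases hs : IsStrictLocalMin g β
  · have h1 : {x : ℝ | x < β ∧ ∀ v ∈ Icc x β, v ≠ β → g β < g v}.OrdConnected :=
      ⟨fun x hx y hy z hz => ⟨hz.2.trans_lt hy.1,
        fun v hv => hx.2 v ⟨hz.1.trans hv.1, hv.2⟩⟩⟩
    have h2 : {y : ℝ | β < y ∧ ∀ v ∈ Icc β y, v ≠ β → g β < g v}.OrdConnected :=
      ⟨fun x hx y hy z hz => ⟨hx.1.trans_le hz.1,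
        fun v hv => hy.2 v ⟨hv.1, hv.2.trans hz.2⟩⟩⟩
    convert h1.measurableSet.prod h2.measurableSet using 1
    ext z
    simp [isMrca_iff, hs]
  · convert MeasurableSet.empty
    simp [isMrca_iff, hs]

lemma measurableSet_tri (g : ℝ → ℝ) (b : ℕ → ℝ) (s : ℕ → Bool) :
    MeasurableSet {z : ℝ × ℝ | Tri g b s z.1 z.2} := by
  have : {z : ℝ × ℝ | Tri g b s z.1 z.2} =
      ⋃ i, ({z : ℝ × ℝ | IsMrca g (b i) z.1 z.2} ∩ {_z | s i = true}) ∪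
        (Prod.swap ⁻¹' {z : ℝ × ℝ | IsMrca g (b i) z.1 z.2} ∩ {_z | s i = false}) := by
    ext z; simp [Tri]
  rw [this]
  exact MeasurableSet.iUnion fun i =>
    ((measurableSet_isMrca g (b i)).inter (MeasurableSet.const _)).union
      ((measurable_swap (measurableSet_isMrca g (b i))).inter (MeasurableSet.const _))

lemma phi_eq (g : ℝ → ℝ) (b : ℕ → ℝ) (s : ℕ → Bool) (t : ℝ) :
    phi g b s t = lebI.real {u | Tri g b s u t} := by
  rw [phi, measureReal_def, Measure.restrict_apply' measurableSet_Icc, inter_comm]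
  rfl

lemma measurable_phi (g : ℝ → ℝ) (b : ℕ → ℝ) (s : ℕ → Bool) : Measurable (phi g b s) := by
  have h : phi g b s =
      fun t => (lebI ((fun u => (u, t)) ⁻¹' {z : ℝ × ℝ | Tri g b s z.1 z.2})).toReal :=
    funext fun t => phi_eq g b s t
  rw [h]
  exact (measurable_measure_prodMk_right (measurableSet_tri g b s)).ennreal_toReal

/-- The part of the predecessors of `t` lying outside an excursion interval around `p`. -/
lemma lebI_tri_diff_excSet {g : ℝ → ℝ} {b : ℕ → ℝ} {s : ℕ → Bool} {p t h : ℝ}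
    (hp : p ∈ Icc (0:ℝ) 1) (ht : t ∈ excSet g p h) :
    lebI.real ({u | Tri g b s u t} \ excSet g p h) =
      lebI.real ({u | Tri g b s u p} \ excSet g p h) := by
  simp only [measureReal_def, Measure.restrict_apply' measurableSet_Icc]
  congr 2
  ext u
  simp only [mem_inter_iff, mem_sdiff, mem_ofPred_eq]
  constructor
  · rintro ⟨⟨h1, h2⟩, h3⟩
    exact ⟨⟨(tri_right_iff hp ht h3 h2).1 h1, h2⟩, h3⟩
  · rintro ⟨⟨h1, h2⟩, h3⟩
    exact ⟨⟨(tri_right_iff hp ht h3 h2).2 h1, h2⟩, h3⟩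

lemma phi_eq_add {g : ℝ → ℝ} {b : ℕ → ℝ} {s : ℕ → Bool} {p t h : ℝ}
    (hp : p ∈ Icc (0:ℝ) 1) (ht : t ∈ excSet g p h) :
    phi g b s t = lebI.real ({u | Tri g b s u t} ∩ excSet g p h) +
      lebI.real ({u | Tri g b s u p} \ excSet g p h) := by
  rw [phi_eq, ← lebI_tri_diff_excSet hp ht,
    measureReal_inter_add_sdiff (measurableSet_excSet g p h)]

lemma abs_phi_sub_le {g : ℝ → ℝ} {b : ℕ → ℝ} {s : ℕ → Bool} {p y z h : ℝ}
    (hp : p ∈ Icc (0:ℝ) 1) (hy : y ∈ excSet g p h) (hz : z ∈ excSet g p h) :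
    |phi g b s y - phi g b s z| ≤ lebI.real (excSet g p h) := by
  rw [phi_eq_add hp hy, phi_eq_add hp hz, add_sub_add_right_eq_sub]
  exact abs_sub_le_of_nonneg_of_le measureReal_nonneg (measureReal_mono inter_subset_right)
    measureReal_nonneg (measureReal_mono inter_subset_right)

lemma lebI_real_Icc {a c : ℝ} (ha : 0 ≤ a) (hac : a ≤ c) (hc : c ≤ 1) :
    lebI.real (Icc a c) = c - a := by
  rw [measureReal_def, Measure.restrict_apply' measurableSet_Icc,
    inter_eq_left.2 (Icc_subset_Icc ha hc), Real.volume_Icc, ENNReal.toReal_ofReal (by linarith)]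

lemma abs_sub_le_of_mem_excSet {g : ℝ → ℝ} {p y z h : ℝ}
    (hy : y ∈ excSet g p h) (hz : z ∈ excSet g p h) :
    |y - z| ≤ lebI.real (excSet g p h) := by
  wlog hyz : y ≤ z generalizing y z
  · rw [abs_sub_comm]; exact this hz hy (le_of_not_ge hyz)
  rw [abs_sub_comm, abs_of_nonneg (by linarith), ← lebI_real_Icc hy.1.1 hyz hz.1.2]
  exact measureReal_mono ((excSet_ordConnected g p h).out hy hz)

lemma IsInnerLocalMin.isStrictLocalMin {g : ℝ → ℝ} (hg : IsCRT g) {v : ℝ}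
    (hv : IsInnerLocalMin g v) : IsStrictLocalMin g v := by
  obtain ⟨hv01, ε, hε, hmin⟩ := id hv
  have hpos : 0 < min ε (min v (1 - v)) :=
    lt_min hε (lt_min hv01.1 (sub_pos.2 hv01.2))
  refine ⟨hv01, min ε (min v (1 - v)), hpos, fun x hx hne => ?_⟩
  have h1 : min ε (min v (1 - v)) ≤ ε := min_le_left _ _
  have h2 : min ε (min v (1 - v)) ≤ v := (min_le_right _ _).trans (min_le_left _ _)
  have h3 : min ε (min v (1 - v)) ≤ 1 - v := (min_le_right _ _).trans (min_le_right _ _)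
  obtain ⟨hx1, hx2⟩ := hx
  have hxε : x ∈ Ioo (v - ε) (v + ε) := ⟨by linarith, by linarith⟩
  refine lt_of_le_of_ne (hmin x hxε) fun heq => hne ?_
  refine hg.distinct x v ⟨⟨by linarith, by linarith⟩, ?_⟩ hv heq.symm
  refine ⟨min (x - (v - ε)) (v + ε - x),
    lt_min (sub_pos.2 hxε.1) (sub_pos.2 hxε.2), fun z hz => ?_⟩
  have h4 := min_le_left (x - (v - ε)) (v + ε - x)
  have h5 := min_le_right (x - (v - ε)) (v + ε - x)
  rw [← heq]
  exact hmin z ⟨by linarith [hz.1], by linarith [hz.2]⟩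

/-- Points of the unit interval whose segment to `p` stays weakly above level `q`. -/
def closedExcSet (g : ℝ → ℝ) (p q : ℝ) : Set ℝ :=
  {u | u ∈ Icc (0:ℝ) 1 ∧ ∀ v ∈ uIcc u p, q ≤ g v}

lemma excSet_subset_closedExcSet (g : ℝ → ℝ) (p q : ℝ) : excSet g p q ⊆ closedExcSet g p q :=
  fun _ hu => ⟨hu.1, fun v hv => (hu.2 v hv).le⟩

lemma closedExcSet_subset_excSet (g : ℝ → ℝ) (p : ℝ) {h q : ℝ} (hq : h < q) :
    closedExcSet g p q ⊆ excSet g p h :=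
  fun _ hu => ⟨hu.1, fun v hv => hq.trans_le (hu.2 v hv)⟩

lemma uIcc_subset_unitInterval {t p : ℝ} (ht : t ∈ Icc (0:ℝ) 1) (hp : p ∈ Icc (0:ℝ) 1) :
    uIcc t p ⊆ Icc 0 1 := (ordConnected_Icc.uIcc_subset ht hp)

lemma exists_min_on_uIcc {g : ℝ → ℝ} (hg : IsCRT g) {t p : ℝ} (ht : t ∈ Icc (0:ℝ) 1)
    (hp : p ∈ Icc (0:ℝ) 1) : ∃ v ∈ uIcc t p, ∀ w ∈ uIcc t p, g v ≤ g w := by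
  obtain ⟨v, hv, hmin⟩ := isCompact_uIcc.exists_isMinOn nonempty_uIcc
    (hg.cont.mono (uIcc_subset_unitInterval ht hp))
  exact ⟨v, hv, fun w hw => hmin hw⟩

lemma NotOneSidedMin.exists_mem_closedExcSet {g : ℝ → ℝ} (hg : IsCRT g) {b : ℕ → ℝ}
    (hb : IsEnum g b) {t p : ℝ} (hp : p ∈ Icc (0:ℝ) 1) (ht : NotOneSidedMin g t) :
    ∃ q ∈ insert (g p) (range fun i => g (b i)), t ∈ closedExcSet g p q \ excSet g p q := by
  have ht01 : t ∈ Icc (0:ℝ) 1 := Ioo_subset_Icc_self ht.1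
  obtain ⟨v, hv, hmin⟩ := exists_min_on_uIcc hg ht01 hp
  refine ⟨g v, ?_, ⟨ht01, hmin⟩, fun hc => (hc.2 v hv).false⟩
  rcases eq_or_ne v p with rfl | hvp
  · exact mem_insert _ _
  have hvt : v ≠ t := by
    rintro rfl
    rcases lt_or_gt_of_ne hvp with h | h
    · obtain ⟨x, hx, hlt⟩ := (ht.2 (p - v) (sub_pos.2 h)).2
      exact hlt.not_ge (hmin x (mem_uIcc.2 (Or.inl ⟨hx.1.le, by linarith [hx.2]⟩)))
    · obtain ⟨x, hx, hlt⟩ := (ht.2 (v - p) (sub_pos.2 h)).1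
      exact hlt.not_ge (hmin x (mem_uIcc.2 (Or.inr ⟨by linarith [hx.1], hx.2.le⟩)))
  have hv1 : min t p < v := lt_of_le_of_ne hv.1 (by grind)
  have hv2 : v < max t p := lt_of_le_of_ne hv.2 (by grind)
  have hin : IsInnerLocalMin g v := by
    refine ⟨⟨(le_min ht01.1 hp.1).trans_lt hv1, hv2.trans_le (max_le ht01.2 hp.2)⟩,
      min (v - min t p) (max t p - v), lt_min (sub_pos.2 hv1) (sub_pos.2 hv2), fun x hx => ?_⟩
    have h4 := min_le_left (v - min t p) (max t p - v)
    have h5 := min_le_right (v - min t p) (max t p - v)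
    exact hmin x ⟨by linarith [hx.1], by linarith [hx.2]⟩
  obtain ⟨i, hi⟩ := (hb.2 v).1 (hin.isStrictLocalMin hg)
  exact Or.inr ⟨i, by simp [hi]⟩

lemma excSet_length_antitone (g : ℝ → ℝ) (p : ℝ) :
    Antitone fun h => lebI.real (excSet g p h) :=
  fun _ _ hk => measureReal_mono (excSet_antitone g p hk)

/-- The excursion intervals around a given point have lengths in a closed null set. -/
lemma volume_closure_range_excSet_length {g : ℝ → ℝ} (hg : IsCRT g) {b : ℕ → ℝ}
    (hb : IsEnum g b) {p : ℝ} (hp : p ∈ Icc (0:ℝ) 1) :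
    volume (closure (range fun h => lebI.real (excSet g p h))) = 0 := by
  set C : Set ℝ := insert (g p) (range fun i => g (b i)) with hC
  have hCc : C.Countable := (countable_range _).insert _
  set D : ℝ → Set ℝ := fun q =>
    Ioo (lebI.real (excSet g p q)) (lebI.real (closedExcSet g p q)) with hD
  have hlow : ∀ {h q : ℝ}, h < q →
      lebI.real (closedExcSet g p q) ≤ lebI.real (excSet g p h) := fun hq =>
    measureReal_mono (closedExcSet_subset_excSet g p hq)
  have hDisj : C.PairwiseDisjoint D := by
    intro q _ q' _ hne
    wlog hlt : q < q' generalizing q q'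
    · exact (this ‹_› ‹_› hne.symm (lt_of_le_of_ne (le_of_not_gt hlt) hne.symm)).symm
    refine Set.disjoint_left.2 fun z hz hz' => ?_
    exact absurd (hlow hlt) (by linarith [hz.1, hz'.2])
  have hle1 : ∀ S : Set ℝ, lebI.real S ≤ 1 := fun S =>
    (measureReal_mono (subset_univ S)).trans (by simp [measureReal_def])
  have hUsub : (⋃ q ∈ C, D q) ⊆ Icc 0 1 :=
    iUnion₂_subset fun q _ z hz => ⟨measureReal_nonneg.trans hz.1.le, hz.2.le.trans (hle1 _)⟩
  have hDm : ∀ q, volume (D q) = lebI (closedExcSet g p q \ excSet g p q) := fun q => by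
    rw [hD, Real.volume_Ioo, ← measureReal_sdiff (excSet_subset_closedExcSet g p q)
      (measurableSet_excSet g p q), measureReal_def, ENNReal.ofReal_toReal (measure_ne_top _ _)]
  have hU : 1 ≤ volume (⋃ q ∈ C, D q) := by
    rw [measure_biUnion hCc hDisj fun q _ => measurableSet_Ioo]
    simp only [hDm]
    refine le_trans ?_ (measure_biUnion_le lebI hCc
      fun q => closedExcSet g p q \ excSet g p q)
    calc (1 : ENNReal) = lebI {x | NotOneSidedMin g x} := by
          rw [Measure.restrict_apply' measurableSet_Icc, inter_eq_left.2, hg.leaves_full]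
          exact fun x hx => Ioo_subset_Icc_self hx.1
      _ ≤ _ := measure_mono fun t ht => by
          obtain ⟨q, hq, hmem⟩ := NotOneSidedMin.exists_mem_closedExcSet hg hb hp ht
          exact mem_biUnion hq hmem
  have hsub : closure (range fun h => lebI.real (excSet g p h)) ⊆ Icc 0 1 \ ⋃ q ∈ C, D q := by
    refine closure_minimal ?_ (isClosed_Icc.sdiff (isOpen_biUnion fun q _ => isOpen_Ioo))
    rintro _ ⟨h, rfl⟩
    refine ⟨⟨measureReal_nonneg, hle1 _⟩, fun hmem => ?_⟩
    obtain ⟨q, _, hz⟩ := mem_iUnion₂.1 hmem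
    rcases le_or_gt q h with hq | hq
    · exact hz.1.not_ge (excSet_length_antitone g p hq)
    · exact hz.2.not_ge (hlow hq)
  refine measure_mono_null hsub ?_
  rw [measure_sdiff hUsub (MeasurableSet.biUnion hCc fun q _ => measurableSet_Ioo).nullMeasurableSet
    (measure_ne_top_of_subset hUsub (by simp)), Real.volume_Icc]
  rw [sub_zero, ENNReal.ofReal_one]
  exact tsub_eq_zero_of_le hU

/-- The point `(x, y)` of the Euclidean plane. -/
abbrev planePt (x y : ℝ) : EuclideanSpace ℝ (Fin 2) :=
  (WithLp.equiv 2 (Fin 2 → ℝ)).symm ![x, y]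

lemma dist_planePt_le {x y x' y' L : ℝ} (hx : |x - x'| ≤ L) (hy : |y - y'| ≤ L) :
    dist (planePt x y) (planePt x' y') ≤ Real.sqrt 2 * L := by
  have hL : 0 ≤ L := (abs_nonneg _).trans hx
  rw [EuclideanSpace.dist_eq, Fin.sum_univ_two]
  simp only [planePt, WithLp.equiv_symm_apply, Matrix.cons_val_zero,
    Matrix.cons_val_one, Real.dist_eq, sq_abs]
  rw [← Real.sqrt_sq hL, ← Real.sqrt_mul (by norm_num)]
  refine Real.sqrt_le_sqrt ?_
  have h1 : (x - x') ^ 2 ≤ L ^ 2 := by rw [← sq_abs]; gcongr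
  have h2 : (y - y') ^ 2 ≤ L ^ 2 := by rw [← sq_abs]; gcongr
  linarith

/-- A curve that is Lipschitz with respect to a parameter ranging over a bounded set with null
closure has closure of zero length. -/
lemma hausdorffMeasure_closure_range_eq_zero {ι : Type*} {f x y : ι → ℝ}
    (hx : ∀ i j, |x i - x j| ≤ |f i - f j|)
    (hy : ∀ i j, |y i - y j| ≤ 2 * |f i - f j|) (hbd : Bornology.IsBounded (range f))
    (h0 : volume (closure (range f)) = 0) :
    μH[1] (closure (range fun i => planePt (x i) (y i))) = 0 := by
  have key : ∀ (c : NNReal) (z : ι → ℝ), (∀ i j, |z i - z j| ≤ c * |f i - f j|) →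
      ∃ G : ℝ → ℝ, LipschitzWith c G ∧ ∀ i, G (f i) = z i := by
    intro c z hz
    rcases isEmpty_or_nonempty ι with hι | hι
    · exact ⟨fun _ => 0, LipschitzWith.const' 0, fun i => (IsEmpty.false i).elim⟩
    have hfac : ∀ i, z (Function.invFun f (f i)) = z i := fun i => by
      have : f (Function.invFun f (f i)) = f i := Function.invFun_eq ⟨i, rfl⟩
      have h := hz (Function.invFun f (f i)) i
      rw [this, sub_self, abs_zero, mul_zero] at h
      exact sub_eq_zero.1 (abs_eq_zero.1 (le_antisymm h (abs_nonneg _)))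
    have hL : LipschitzOnWith c (fun r => z (Function.invFun f r)) (range f) := by
      refine LipschitzOnWith.of_dist_le_mul ?_
      rintro _ ⟨i, rfl⟩ _ ⟨j, rfl⟩
      simpa only [hfac] using! hz i j
    obtain ⟨G, hG, hGe⟩ := hL.extend_real
    exact ⟨G, hG, fun i => (hGe ⟨i, rfl⟩).symm.trans (hfac i)⟩
  obtain ⟨X, hX, hXe⟩ := key 1 x (by simpa using hx)
  obtain ⟨Y, hY, hYe⟩ := key 2 y (by simpa using hy)
  have hF : LipschitzWith (Real.toNNReal (Real.sqrt 2 * 2)) fun r => planePt (X r) (Y r) := by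
    refine LipschitzWith.of_dist_le_mul fun r r' => ?_
    rw [Real.coe_toNNReal _ (by positivity), mul_assoc]
    refine dist_planePt_le ?_ ?_
    · have h := hX.dist_le_mul r r'
      simp only [Real.dist_eq, NNReal.coe_one, one_mul] at h ⊢
      linarith [abs_nonneg (r - r')]
    · simpa [Real.dist_eq] using hY.dist_le_mul r r'
  have hcpt : IsCompact (closure (range f)) := hbd.isCompact_closure
  have hsub : closure (range fun i => planePt (x i) (y i)) ⊆
      (fun r => planePt (X r) (Y r)) '' closure (range f) := by
    refine closure_minimal ?_ (hcpt.image hF.continuous).isClosed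
    rintro _ ⟨i, rfl⟩
    exact ⟨f i, subset_closure ⟨i, rfl⟩, by simp only [hXe, hYe]⟩
  refine measure_mono_null hsub (le_antisymm ?_ zero_le)
  refine (hF.hausdorffMeasure_image_le zero_le_one _).trans ?_
  rw [hausdorffMeasure_real, h0, mul_zero]

section Spine

variable {g : ℝ → ℝ} {b : ℕ → ℝ} {s : ℕ → Bool} {p : ℝ}

lemma abs_lebI_inter_excSet_sub_le (g : ℝ → ℝ) (p : ℝ) (A : Set ℝ) (h k : ℝ) :
    |lebI.real (A ∩ excSet g p h) - lebI.real (A ∩ excSet g p k)| ≤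
      |lebI.real (excSet g p h) - lebI.real (excSet g p k)| := by
  wlog hk : h ≤ k generalizing h k
  · rw [abs_sub_comm, abs_sub_comm (lebI.real (excSet g p h))]
    exact this k h (le_of_not_ge hk)
  have hsub := excSet_antitone g p hk
  have h1 : lebI.real (A ∩ excSet g p h) ≤
      lebI.real (A ∩ excSet g p k) + lebI.real (excSet g p h \ excSet g p k) := by
    refine (measureReal_mono ?_).trans (measureReal_union_le _ _)
    intro u hu
    by_cases hc : u ∈ excSet g p k
    · exact Or.inl ⟨hu.1, hc⟩
    · exact Or.inr ⟨hu.2, hc⟩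
  rw [measureReal_sdiff hsub (measurableSet_excSet g p k)] at h1
  rw [abs_of_nonneg (sub_nonneg.2 (measureReal_mono (inter_subset_inter_right A hsub))),
    abs_of_nonneg (sub_nonneg.2 (measureReal_mono hsub))]
  linarith

/-- First coordinate of the left (`σ = true`) or right end of an excursion interval around `p`. -/
def spineX (g : ℝ → ℝ) (p : ℝ) (σ : Bool) (h : ℝ) : ℝ :=
  if σ then p - lebI.real (Iic p ∩ excSet g p h) else p + lebI.real (Ioi p ∩ excSet g p h)

/-- Upper (`τ = true`) or lower end of the image of an excursion interval around `p`. -/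
def spineY (g : ℝ → ℝ) (b : ℕ → ℝ) (s : ℕ → Bool) (p : ℝ) (τ : Bool) (h : ℝ) : ℝ :=
  lebI.real ({u | Tri g b s u p} \ excSet g p h) + if τ then lebI.real (excSet g p h) else 0

/-- The corners of the boxes containing the graph of `phi` above excursion intervals around `p`. -/
def spine (g : ℝ → ℝ) (b : ℕ → ℝ) (s : ℕ → Bool) (p : ℝ) : Set (EuclideanSpace ℝ (Fin 2)) :=
  ⋃ (σ : Bool) (τ : Bool), range fun h => planePt (spineX g p σ h) (spineY g b s p τ h)

lemma hausdorffMeasure_closure_spine (hg : IsCRT g) (hb : IsEnum g b) (s : ℕ → Bool)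
    (hp : p ∈ Icc (0:ℝ) 1) : μH[1] (closure (spine g b s p)) = 0 := by
  simp only [spine, closure_iUnion_of_finite, measure_iUnion_null_iff]
  intro σ τ
  refine hausdorffMeasure_closure_range_eq_zero (f := fun h => lebI.real (excSet g p h)) ?_ ?_ ?_
    (volume_closure_range_excSet_length hg hb hp)
  · intro h k
    cases σ <;> simp only [spineX, Bool.false_eq_true, if_true, if_false]
    · rw [add_sub_add_left_eq_sub]
      exact abs_lebI_inter_excSet_sub_le g p _ h k
    · rw [sub_sub_sub_cancel_left, abs_sub_comm]
      exact abs_lebI_inter_excSet_sub_le g p _ h k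
  · intro h k
    have hd : ∀ r, lebI.real ({u | Tri g b s u p} \ excSet g p r) =
        lebI.real {u | Tri g b s u p} - lebI.real ({u | Tri g b s u p} ∩ excSet g p r) := fun r => by
      rw [← measureReal_inter_add_sdiff (s := {u | Tri g b s u p}) (measurableSet_excSet g p r)]
      ring
    have h1 := abs_le.1 (abs_lebI_inter_excSet_sub_le g p {u | Tri g b s u p} h k)
    have h2 := abs_le.1
      (le_refl |lebI.real (excSet g p h) - lebI.real (excSet g p k)|)
    rw [abs_le]
    cases τ <;> simp only [spineY, hd, Bool.false_eq_true, if_true, if_false] <;>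
      constructor <;> linarith [h1.1, h1.2, h2.1, h2.2]
  · refine (Metric.isBounded_Icc (0:ℝ) 1).subset ?_
    rintro _ ⟨h, rfl⟩
    exact ⟨measureReal_nonneg, (measureReal_mono (subset_univ _)).trans (by simp [measureReal_def])⟩

lemma exists_spineX_near {t h k : ℝ} (hp : p ∈ Icc (0:ℝ) 1) (ht : t ∈ excSet g p h)
    (htk : t ∉ excSet g p k) (hk : k < g p) : ∃ σ, |t - spineX g p σ h| ≤
      lebI.real (excSet g p h) - lebI.real (excSet g p k) := by
  have hpk : p ∈ excSet g p k := ⟨hp, by simpa using hk⟩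
  have hhk : h ≤ k := le_of_not_ge fun hc => htk (excSet_antitone g p hc ht)
  have hph : p ∈ excSet g p h := excSet_antitone g p hhk hpk
  have hnn := sub_nonneg.2 (measureReal_mono (μ := lebI) (excSet_antitone g p hhk))
  have hk1 := (excSet_ordConnected g p k).out
  rcases le_total t p with htp | htp
  · refine ⟨true, ?_⟩
    have h1 := abs_le.1 (abs_lebI_inter_excSet_sub_le g p (Iic p) h k)
    rw [abs_of_nonneg hnn] at h1
    have h2 : p - t ≤ lebI.real (Iic p ∩ excSet g p h) := by
      rw [← lebI_real_Icc ht.1.1 htp hp.2]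
      exact measureReal_mono fun v hv => ⟨hv.2, (excSet_ordConnected g p h).out ht hph hv⟩
    have h3 : lebI.real (Iic p ∩ excSet g p k) ≤ p - t := by
      rw [← lebI_real_Icc ht.1.1 htp hp.2]
      refine measureReal_mono fun v hv => ⟨?_, hv.1⟩
      by_contra hc
      exact htk (hk1 hv.2 hpk ⟨(not_le.1 hc).le, htp⟩)
    simp only [spineX, if_true]
    rw [abs_le]
    constructor <;> linarith [h1.1, h1.2]
  · refine ⟨false, ?_⟩
    have h1 := abs_le.1 (abs_lebI_inter_excSet_sub_le g p (Ioi p) h k)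
    rw [abs_of_nonneg hnn] at h1
    have h2 : t - p ≤ lebI.real (Ioi p ∩ excSet g p h) := by
      rw [← lebI_real_Icc hp.1 htp ht.1.2, measureReal_def, ← measure_congr (Ioc_ae_eq_Icc)]
      exact measureReal_mono fun v hv => ⟨hv.1,
        (excSet_ordConnected g p h).out hph ht ⟨hv.1.le, hv.2⟩⟩
    have h3 : lebI.real (Ioi p ∩ excSet g p k) ≤ t - p := by
      rw [← lebI_real_Icc hp.1 htp ht.1.2]
      refine measureReal_mono fun v hv => ⟨hv.1.le, ?_⟩
      by_contra hc
      exact htk (hk1 hpk hv.2 ⟨htp, (not_le.1 hc).le⟩)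
    simp only [spineX, Bool.false_eq_true, if_false]
    rw [abs_le]
    constructor <;> linarith [h1.1, h1.2]

lemma exists_spineY_near {t h k : ℝ} (b : ℕ → ℝ) (s : ℕ → Bool) (hp : p ∈ Icc (0:ℝ) 1)
    (ht : t ∈ excSet g p h) (htk : t ∉ excSet g p k) :
    ∃ τ, |phi g b s t - spineY g b s p τ h| ≤
      lebI.real (excSet g p h) - lebI.real (excSet g p k) := by
  have hhk : h ≤ k := le_of_not_ge fun hc => htk (excSet_antitone g p hc ht)
  have hsub := excSet_antitone g p hhk
  have hle := measureReal_mono (μ := lebI)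
    (inter_subset_right (s := {u | Tri g b s u t}) (t := excSet g p h))
  rw [phi_eq_add hp ht]
  by_cases hT : Tri g b s p t
  · refine ⟨true, ?_⟩
    have h1 : lebI.real (excSet g p k) ≤ lebI.real ({u | Tri g b s u t} ∩ excSet g p h) :=
      measureReal_mono fun u hu => ⟨(tri_left_iff hp hu ht.1 htk).2 hT, hsub hu⟩
    simp only [spineY, if_true]
    rw [abs_le]
    constructor <;> linarith
  · refine ⟨false, ?_⟩
    have h1 : lebI.real ({u | Tri g b s u t} ∩ excSet g p h) ≤
        lebI.real (excSet g p h) - lebI.real (excSet g p k) := by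
      rw [← measureReal_sdiff hsub (measurableSet_excSet g p k)]
      exact measureReal_mono fun u hu =>
        ⟨hu.2, fun huk => hT ((tri_left_iff hp huk ht.1 htk).1 hu.1)⟩
    have h0 : 0 ≤ lebI.real ({u | Tri g b s u t} ∩ excSet g p h) := measureReal_nonneg
    simp only [spineY, Bool.false_eq_true, if_false]
    rw [abs_le]
    constructor <;> linarith

/-- A point lying between two excursion intervals around `p` of almost the same length
is close to the spine of `p`. -/
lemma exists_mem_spine_near {t h k : ℝ} (b : ℕ → ℝ) (s : ℕ → Bool) (hp : p ∈ Icc (0:ℝ) 1)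
    (ht : t ∈ excSet g p h) (htk : t ∉ excSet g p k) (hk : k < g p) :
    ∃ z ∈ spine g b s p, dist (planePt t (phi g b s t)) z ≤
      Real.sqrt 2 * (lebI.real (excSet g p h) - lebI.real (excSet g p k)) := by
  obtain ⟨σ, hσ⟩ := exists_spineX_near hp ht htk hk
  obtain ⟨τ, hτ⟩ := exists_spineY_near b s hp ht htk
  exact ⟨_, mem_iUnion₂.2 ⟨σ, τ, h, rfl⟩, dist_planePt_le hσ hτ⟩

lemma exists_lt_mem_excSet (hg : IsCRT g) {t c : ℝ} (hp : p ∈ Icc (0:ℝ) 1)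
    (ht : t ∈ excSet g p c) : ∃ h > c, t ∈ excSet g p h := by
  obtain ⟨v, hv, hmin⟩ := exists_min_on_uIcc hg ht.1 hp
  obtain ⟨h, hch, hhv⟩ := exists_between (ht.2 v hv)
  exact ⟨h, hch, ht.1, fun w hw => hhv.trans_le (hmin w hw)⟩

lemma exists_lengths_close_gt (g : ℝ → ℝ) (p c : ℝ) {ε : ℝ} (hε : 0 < ε) :
    ∃ κ > 0, ∀ h ∈ Ioo c (c + κ), ∀ k ∈ Ioo c (c + κ),
      lebI.real (excSet g p h) - lebI.real (excSet g p k) < ε := by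
  have hlim := (excSet_length_antitone g p).tendsto_nhdsGT c
  obtain ⟨κ, hκ, hsub⟩ := (mem_nhdsGT_iff_exists_Ioo_subset).1
    (hlim (Metric.ball_mem_nhds _ (half_pos hε)))
  have hκ' : c < κ := hκ
  refine ⟨κ - c, sub_pos.2 hκ', fun h hh k hk => ?_⟩
  rw [add_sub_cancel] at hh hk
  have h1 := hsub hh
  have h2 := hsub hk
  simp only [mem_preimage, Metric.mem_ball, Real.dist_eq] at h1 h2
  linarith [(abs_lt.1 h1).2, (abs_lt.1 h2).1]

lemma exists_lengths_close_lt (g : ℝ → ℝ) (p c : ℝ) {ε : ℝ} (hε : 0 < ε) :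
    ∃ κ > 0, ∀ h ∈ Ioo (c - κ) c, ∀ k ∈ Ioo (c - κ) c,
      lebI.real (excSet g p h) - lebI.real (excSet g p k) < ε := by
  have hlim := (excSet_length_antitone g p).tendsto_nhdsLT c
  obtain ⟨κ, hκ, hsub⟩ := (mem_nhdsLT_iff_exists_Ioo_subset).1
    (hlim (Metric.ball_mem_nhds _ (half_pos hε)))
  have hκ' : κ < c := hκ
  refine ⟨c - κ, sub_pos.2 hκ', fun h hh k hk => ?_⟩
  rw [sub_sub_cancel] at hh hk
  have h1 := hsub hh
  have h2 := hsub hk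
  simp only [mem_preimage, Metric.mem_ball, Real.dist_eq] at h1 h2
  linarith [(abs_lt.1 h1).2, (abs_lt.1 h2).1]

end Spine

section NonLeaf

variable {g : ℝ → ℝ} {x p : ℝ}

lemma exists_near_spine_of_mem_uIcc (hg : IsCRT g) (b : ℕ → ℝ) (s : ℕ → Bool)
    (hx : x ∈ Icc (0:ℝ) 1) (hp : p ∈ Icc (0:ℝ) 1) (hne : p ≠ x)
    (hpx : ∀ v ∈ uIcc x p, v ≠ x → g x < g v) {ε : ℝ} (hε : 0 < ε) :
    ∃ δ > 0, ∀ t ∈ uIcc x p, t ≠ x → |t - x| < δ →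
      ∃ z ∈ spine g b s p, dist (planePt t (phi g b s t)) z < ε := by
  have h2 : 0 < Real.sqrt 2 := by positivity
  obtain ⟨κ, hκ, hclose⟩ := exists_lengths_close_gt g p (g x) (div_pos hε h2)
  have hxp : g x < g p := hpx p right_mem_uIcc hne
  obtain ⟨δ, hδ, hcont⟩ := Metric.continuousWithinAt_iff.1 (hg.cont x hx) (min κ (g p - g x))
    (lt_min hκ (sub_pos.2 hxp))
  refine ⟨δ, hδ, fun t ht htx htδ => ?_⟩
  have ht01 := uIcc_subset_unitInterval hx hp ht
  have hgt := (abs_lt.1 (hcont ht01 htδ)).2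
  have hκ1 := min_le_left κ (g p - g x)
  have hκ2 := min_le_right κ (g p - g x)
  have htc : t ∈ excSet g p (g x) := ⟨ht01, fun v hv => by
    simp only [mem_uIcc] at ht hv
    exact hpx v (mem_uIcc.2 (by grind)) (by grind)⟩
  obtain ⟨h, hch, hth⟩ := exists_lt_mem_excSet hg hp htc
  have hhk : h < g t := hth.2 t left_mem_uIcc
  have htk : t ∉ excSet g p (g t) := fun hc => (hc.2 t left_mem_uIcc).false
  obtain ⟨z, hz, hdist⟩ := exists_mem_spine_near b s hp hth htk (by linarith)
  refine ⟨z, hz, hdist.trans_lt ?_⟩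
  have := hclose h ⟨hch, by linarith⟩ (g t) ⟨by linarith, by linarith⟩
  rwa [lt_div_iff₀' h2] at this

lemma exists_near_spine_of_uIcc_mem (hg : IsCRT g) (b : ℕ → ℝ) (s : ℕ → Bool)
    (hx : x ∈ Icc (0:ℝ) 1) (hp : p ∈ Icc (0:ℝ) 1)
    (hpx : ∀ v ∈ uIcc x p, v ≠ x → g x < g v) {ε : ℝ} (hε : 0 < ε) :
    ∃ δ > 0, ∀ t ∈ Icc (0:ℝ) 1, x ∈ uIcc t p → (∃ v ∈ uIcc x t, g v < g x) → |t - x| < δ →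
      ∃ z ∈ spine g b s p, dist (planePt t (phi g b s t)) z < ε := by
  have h2 : 0 < Real.sqrt 2 := by positivity
  obtain ⟨κ, hκ, hclose⟩ := exists_lengths_close_lt g p (g x) (div_pos hε h2)
  have hxv : ∀ v ∈ uIcc x p, g x ≤ g v := fun v hv => by
    rcases eq_or_ne v x with rfl | hvx
    · exact le_rfl
    · exact (hpx v hv hvx).le
  obtain ⟨δ, hδ, hcont⟩ := Metric.continuousWithinAt_iff.1 (hg.cont x hx) κ hκ
  refine ⟨δ, hδ, fun t ht01 hxt ⟨w, hw, hwx⟩ htδ => ?_⟩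
  have hnear : ∀ v ∈ uIcc x t, g x - κ < g v := fun v hv => by
    have h1 : |v - x| < δ := (abs_sub_left_of_mem_uIcc hv).trans_lt htδ
    have := (abs_lt.1 (hcont (uIcc_subset_unitInterval hx ht01 hv) h1)).1
    linarith
  have htc : t ∈ excSet g p (g x - κ) := ⟨ht01, fun v hv => by
    rcases uIcc_subset_union t x p hv with h' | h'
    · exact hnear v (uIcc_comm t x ▸ h')
    · linarith [hxv v h']⟩
  obtain ⟨h, hch, hth⟩ := exists_lt_mem_excSet hg hp htc
  have hwp : w ∈ uIcc t p := by
    simp only [mem_uIcc] at *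
    grind
  have hhk : h < g w := hth.2 w hwp
  have htk : t ∉ excSet g p (g w) := fun hc => (hc.2 w hwp).false
  obtain ⟨z, hz, hdist⟩ :=
    exists_mem_spine_near b s hp hth htk (hwx.trans_le (hxv p right_mem_uIcc))
  refine ⟨z, hz, hdist.trans_lt ?_⟩
  have := hclose h ⟨hch, by linarith⟩ (g w) ⟨hnear w hw, hwx⟩
  rwa [lt_div_iff₀' h2] at this

lemma isInnerLocalMin_of_mem_Ioo {a c r : ℝ} (ha : 0 ≤ a) (hc : c ≤ 1) (hr : r ∈ Ioo a c)
    (hmin : ∀ v ∈ Ioo a c, g r ≤ g v) : IsInnerLocalMin g r := by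
  refine ⟨⟨ha.trans_lt hr.1, hr.2.trans_le hc⟩, min (r - a) (c - r),
    lt_min (sub_pos.2 hr.1) (sub_pos.2 hr.2), fun v hv => hmin v ?_⟩
  have h4 := min_le_left (r - a) (c - r)
  have h5 := min_le_right (r - a) (c - r)
  exact ⟨by linarith [hv.1], by linarith [hv.2]⟩

/-- `g` lies strictly above `g x` on a right neighbourhood of `x`. -/
def RightAbove (g : ℝ → ℝ) (x : ℝ) : Prop :=
  ∃ q, x < q ∧ q ≤ 1 ∧ ∀ v ∈ Ioc x q, g x < g v

/-- `g` lies strictly above `g x` on a left neighbourhood of `x`. -/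
def LeftAbove (g : ℝ → ℝ) (x : ℝ) : Prop :=
  ∃ q, q < x ∧ 0 ≤ q ∧ ∀ v ∈ Ico q x, g x < g v

lemma exists_lt_of_not_rightAbove (hg : IsCRT g) (h0 : 0 ≤ x) (h1 : x < 1)
    (hn : ¬ RightAbove g x) {ε : ℝ} (hε : 0 < ε) : ∃ v ∈ Ioo x (x + ε), g v < g x := by
  by_contra! hc
  apply hn
  have hlt : x < min (x + ε) 1 := lt_min (by linarith) h1
  have hge : ∀ v ∈ Ioo x (min (x + ε) 1), g x ≤ g v := fun v hv =>
    hc v ⟨hv.1, hv.2.trans_le (min_le_left _ _)⟩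
  have hloc : ∀ r ∈ Ioo x (min (x + ε) 1), g r = g x → IsInnerLocalMin g r := fun r hr he =>
    isInnerLocalMin_of_mem_Ioo h0 (min_le_right _ _) hr fun v hv => he ▸ hge v hv
  have key : ∀ m, x < m → m ≤ min (x + ε) 1 → (∀ v ∈ Ioo x m, g v ≠ g x) → RightAbove g x := by
    intro m hxm hm hv
    obtain ⟨q, hq1, hq2⟩ := exists_between hxm
    refine ⟨q, hq1, (hq2.le.trans hm).trans (min_le_right _ _), fun v hv' => ?_⟩
    exact lt_of_le_of_ne (hge v ⟨hv'.1, (hv'.2.trans_lt hq2).trans_le hm⟩)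
      (hv v ⟨hv'.1, hv'.2.trans_lt hq2⟩).symm
  by_cases hr : ∃ r ∈ Ioo x (min (x + ε) 1), g r = g x
  · obtain ⟨r, hr, he⟩ := hr
    refine key r hr.1 hr.2.le fun v hv hve => hv.2.ne ?_
    exact hg.distinct v r (hloc v ⟨hv.1, hv.2.trans hr.2⟩ hve) (hloc r hr he) (hve.trans he.symm)
  · exact key _ hlt le_rfl fun v hv hve => hr ⟨v, hv, hve⟩

lemma exists_lt_of_not_leftAbove (hg : IsCRT g) (h0 : 0 < x) (h1 : x ≤ 1)
    (hn : ¬ LeftAbove g x) {ε : ℝ} (hε : 0 < ε) : ∃ v ∈ Ioo (x - ε) x, g v < g x := by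
  by_contra! hc
  apply hn
  have hlt : max (x - ε) 0 < x := max_lt (by linarith) h0
  have hge : ∀ v ∈ Ioo (max (x - ε) 0) x, g x ≤ g v := fun v hv =>
    hc v ⟨(le_max_left _ _).trans_lt hv.1, hv.2⟩
  have hloc : ∀ r ∈ Ioo (max (x - ε) 0) x, g r = g x → IsInnerLocalMin g r := fun r hr he =>
    isInnerLocalMin_of_mem_Ioo (le_max_right _ _) h1 hr fun v hv => he ▸ hge v hv
  have key : ∀ m, m < x → max (x - ε) 0 ≤ m → (∀ v ∈ Ioo m x, g v ≠ g x) → LeftAbove g x := by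
    intro m hxm hm hv
    obtain ⟨q, hq1, hq2⟩ := exists_between hxm
    refine ⟨q, hq2, ((le_max_right _ _).trans hm).trans hq1.le, fun v hv' => ?_⟩
    exact lt_of_le_of_ne (hge v ⟨hm.trans_lt (hq1.trans_le hv'.1), hv'.2⟩)
      (hv v ⟨hq1.trans_le hv'.1, hv'.2⟩).symm
  by_cases hr : ∃ r ∈ Ioo (max (x - ε) 0) x, g r = g x
  · obtain ⟨r, hr, he⟩ := hr
    refine key r hr.2 hr.1.le fun v hv hve => hv.1.ne' ?_
    exact hg.distinct v r (hloc v ⟨hr.1.trans hv.1, hv.2⟩ hve) (hloc r hr he) (hve.trans he.symm)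
  · exact key _ hlt le_rfl fun v hv hve => hr ⟨v, hv, hve⟩

lemma RightAbove.exists_rat (h0 : 0 ≤ x) (h : RightAbove g x) :
    ∃ p : ℚ, x < p ∧ (p:ℝ) ∈ Icc (0:ℝ) 1 ∧ ∀ v ∈ uIcc x (p:ℝ), v ≠ x → g x < g v := by
  obtain ⟨q, hxq, hq1, hv⟩ := h
  obtain ⟨p, hp1, hp2⟩ := exists_rat_btwn hxq
  refine ⟨p, hp1, ⟨by linarith, by linarith⟩, fun v hvp hne => ?_⟩
  rw [uIcc_of_le hp1.le] at hvp
  exact hv v ⟨lt_of_le_of_ne hvp.1 hne.symm, hvp.2.trans hp2.le⟩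

lemma LeftAbove.exists_rat (h1 : x ≤ 1) (h : LeftAbove g x) :
    ∃ p : ℚ, p < x ∧ (p:ℝ) ∈ Icc (0:ℝ) 1 ∧ ∀ v ∈ uIcc x (p:ℝ), v ≠ x → g x < g v := by
  obtain ⟨q, hxq, hq1, hv⟩ := h
  obtain ⟨p, hp1, hp2⟩ := exists_rat_btwn hxq
  refine ⟨p, hp2, ⟨by linarith, by linarith⟩, fun v hvp hne => ?_⟩
  rw [uIcc_of_ge hp2.le] at hvp
  exact hv v ⟨hp1.le.trans hvp.1, lt_of_le_of_ne hvp.2 hne⟩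

/-- Around a point of the skeleton, the graph of `phi` is asymptotically close to at most two
spines. -/
lemma exists_near_spine_of_not_notOneSidedMin (hg : IsCRT g) (b : ℕ → ℝ) (s : ℕ → Bool)
    (hx : x ∈ Icc (0:ℝ) 1) (hnl : ¬ NotOneSidedMin g x) :
    ∃ p p' : ℚ, (p:ℝ) ∈ Icc (0:ℝ) 1 ∧ (p':ℝ) ∈ Icc (0:ℝ) 1 ∧ ∀ ε > 0, ∃ δ > 0,
      ∀ t ∈ Icc (0:ℝ) 1, t ≠ x → |t - x| < δ →
        ∃ z ∈ spine g b s p ∪ spine g b s p', dist (planePt t (phi g b s t)) z < ε := by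
  have hR0 : x = 0 → RightAbove g x := by
    rintro rfl
    exact ⟨1 / 2, by norm_num, by norm_num, fun v hv => by
      rw [hg.zero0]; exact hg.pos v ⟨hv.1, hv.2.trans_lt (by norm_num)⟩⟩
  have hL1 : x = 1 → LeftAbove g x := by
    rintro rfl
    exact ⟨1 / 2, by norm_num, by norm_num, fun v hv => by
      rw [hg.zero1]; exact hg.pos v ⟨lt_of_lt_of_le (by norm_num) hv.1, hv.2⟩⟩
  by_cases hR : RightAbove g x <;> by_cases hL : LeftAbove g x
  · obtain ⟨p, hxp, hp, hpv⟩ := hR.exists_rat hx.1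
    obtain ⟨p', hxp', hp', hpv'⟩ := hL.exists_rat hx.2
    refine ⟨p, p', hp, hp', fun ε hε => ?_⟩
    obtain ⟨δ, hδ, h⟩ := exists_near_spine_of_mem_uIcc hg b s hx hp hxp.ne' hpv hε
    obtain ⟨δ', hδ', h'⟩ := exists_near_spine_of_mem_uIcc hg b s hx hp' hxp'.ne hpv' hε
    refine ⟨min (min δ δ') (min (p - x) (x - p')), by
      simp [hδ, hδ', hxp, hxp'], fun t ht htx hd => ?_⟩
    simp only [lt_min_iff, abs_lt] at hd
    rcases lt_or_gt_of_ne htx with hlt | hgt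
    · obtain ⟨z, hz, hzd⟩ := h' t (mem_uIcc.2 (Or.inr ⟨by linarith [hd.2.2.1], hlt.le⟩)) htx
        (abs_lt.2 hd.1.2)
      exact ⟨z, Or.inr hz, hzd⟩
    · obtain ⟨z, hz, hzd⟩ := h t (mem_uIcc.2 (Or.inl ⟨hgt.le, by linarith [hd.2.1.2]⟩)) htx
        (abs_lt.2 hd.1.1)
      exact ⟨z, Or.inl hz, hzd⟩
  · obtain ⟨p, hxp, hp, hpv⟩ := hR.exists_rat hx.1
    refine ⟨p, p, hp, hp, fun ε hε => ?_⟩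
    obtain ⟨δ, hδ, h⟩ := exists_near_spine_of_mem_uIcc hg b s hx hp hxp.ne' hpv hε
    obtain ⟨δ', hδ', h'⟩ := exists_near_spine_of_uIcc_mem hg b s hx hp hpv hε
    refine ⟨min (min δ δ') (p - x), by simp [hδ, hδ', hxp], fun t ht htx hd => ?_⟩
    simp only [lt_min_iff, abs_lt, union_self] at hd ⊢
    rcases lt_or_gt_of_ne htx with hlt | hgt
    · obtain ⟨v, hv, hvx⟩ :=
        exists_lt_of_not_leftAbove hg (ht.1.trans_lt hlt) hx.2 hL (sub_pos.2 hlt)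
      refine h' t ht (mem_uIcc.2 (Or.inl ⟨hlt.le, hxp.le⟩)) ⟨v, mem_uIcc.2 (Or.inr ?_), hvx⟩
        (abs_lt.2 hd.1.2)
      exact ⟨by linarith [hv.1], hv.2.le⟩
    · exact h t (mem_uIcc.2 (Or.inl ⟨hgt.le, by linarith [hd.2.2]⟩)) htx (abs_lt.2 hd.1.1)
  · obtain ⟨p, hxp, hp, hpv⟩ := hL.exists_rat hx.2
    refine ⟨p, p, hp, hp, fun ε hε => ?_⟩
    obtain ⟨δ, hδ, h⟩ := exists_near_spine_of_mem_uIcc hg b s hx hp hxp.ne hpv hε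
    obtain ⟨δ', hδ', h'⟩ := exists_near_spine_of_uIcc_mem hg b s hx hp hpv hε
    refine ⟨min (min δ δ') (x - p), by simp [hδ, hδ', hxp], fun t ht htx hd => ?_⟩
    simp only [lt_min_iff, abs_lt, union_self] at hd ⊢
    rcases lt_or_gt_of_ne htx with hlt | hgt
    · exact h t (mem_uIcc.2 (Or.inr ⟨by linarith [hd.2.1], hlt.le⟩)) htx (abs_lt.2 hd.1.1)
    · obtain ⟨v, hv, hvx⟩ :=
        exists_lt_of_not_rightAbove hg hx.1 (hgt.trans_le ht.2) hR (sub_pos.2 hgt)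
      refine h' t ht (mem_uIcc.2 (Or.inr ⟨hxp.le, hgt.le⟩)) ⟨v, mem_uIcc.2 (Or.inl ?_), hvx⟩
        (abs_lt.2 hd.1.2)
      exact ⟨hv.1.le, by linarith [hv.2]⟩
  · have h0 : 0 < x := lt_of_le_of_ne hx.1 fun h => hR (hR0 h.symm)
    have h1 : x < 1 := lt_of_le_of_ne hx.2 fun h => hL (hL1 h)
    exact absurd ⟨⟨h0, h1⟩, fun ε hε => ⟨exists_lt_of_not_leftAbove hg h0 h1.le hL hε,
      exists_lt_of_not_rightAbove hg h0.le h1 hR hε⟩⟩ hnl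

end NonLeaf

section Leaves

variable {g : ℝ → ℝ} {x : ℝ}

/-- The union of the components of superlevel sets of `g` around `x` of length at most `δ`. -/
def smallExcSet (g : ℝ → ℝ) (δ x : ℝ) : Set ℝ :=
  {y | ∃ h, y ∈ excSet g x h ∧ lebI.real (excSet g x h) ≤ δ}

lemma excSet_subset_smallExcSet {δ h : ℝ} (hδ : lebI.real (excSet g x h) ≤ δ) :
    excSet g x h ⊆ smallExcSet g δ x := fun _ hy => ⟨h, hy, hδ⟩

lemma exists_mem_excSet_of_mem_smallExcSet {δ y z : ℝ} (hy : y ∈ smallExcSet g δ x)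
    (hz : z ∈ smallExcSet g δ x) :
    ∃ h, y ∈ excSet g x h ∧ z ∈ excSet g x h ∧ lebI.real (excSet g x h) ≤ δ := by
  obtain ⟨h, hyh, hh⟩ := hy
  obtain ⟨k, hzk, hk⟩ := hz
  rcases le_total h k with hle | hle
  · exact ⟨h, hyh, excSet_antitone g x hle hzk, hh⟩
  · exact ⟨k, excSet_antitone g x hle hyh, hzk, hk⟩

lemma measurableSet_smallExcSet (g : ℝ → ℝ) (δ x : ℝ) : MeasurableSet (smallExcSet g δ x) := by
  refine OrdConnected.measurableSet ⟨fun u hu w hw => ?_⟩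
  obtain ⟨h, huh, hwh, hh⟩ := exists_mem_excSet_of_mem_smallExcSet hu hw
  exact ((excSet_ordConnected g x h).out huh hwh).trans (excSet_subset_smallExcSet hh)

lemma smallExcSet_subset_Icc (g : ℝ → ℝ) (δ x : ℝ) : smallExcSet g δ x ⊆ Icc 0 1 :=
  fun _ ⟨_, hy, _⟩ => hy.1

lemma smallExcSet_eq_of_mem {δ y : ℝ} (hx : x ∈ Icc (0:ℝ) 1) (hy : y ∈ smallExcSet g δ x) :
    smallExcSet g δ y = smallExcSet g δ x := by
  have key : ∀ {x y : ℝ}, x ∈ Icc (0:ℝ) 1 → y ∈ smallExcSet g δ x →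
      smallExcSet g δ y ⊆ smallExcSet g δ x ∧ x ∈ smallExcSet g δ y := by
    rintro x y hx ⟨h, hyh, hh⟩
    have heq := excSet_eq_of_mem hx hyh
    refine ⟨?_, h, mem_excSet_symm hx hyh, heq ▸ hh⟩
    rintro z ⟨k, hzk, hk⟩
    rcases le_total h k with hle | hle
    · exact ⟨h, heq ▸ excSet_antitone g y hle hzk, hh⟩
    · have heq' := excSet_eq_of_mem hx (excSet_antitone g x hle hyh)
      exact ⟨k, heq' ▸ hzk, heq' ▸ hk⟩
  obtain ⟨h1, h2⟩ := key hx hy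
  exact h1.antisymm (key (smallExcSet_subset_Icc g δ x hy) h2).1

lemma NotOneSidedMin.smallExcSet_mem_nhds (hg : IsCRT g) (hx : NotOneSidedMin g x) {δ : ℝ}
    (hδ : 0 < δ) : smallExcSet g δ x ∈ nhds x := by
  obtain ⟨hx01, hx⟩ := hx
  obtain ⟨hε0, hεx, hε1⟩ : 0 < min (δ / 2) (min x (1 - x)) ∧
      min (δ / 2) (min x (1 - x)) ≤ x ∧ min (δ / 2) (min x (1 - x)) ≤ 1 - x :=
    ⟨lt_min (by linarith) (lt_min hx01.1 (by linarith [hx01.2])), by simp, by simp⟩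
  have hεδ : min (δ / 2) (min x (1 - x)) ≤ δ / 2 := min_le_left _ _
  set ε := min (δ / 2) (min x (1 - x))
  obtain ⟨⟨y, hy, hyg⟩, ⟨z, hz, hzg⟩⟩ := hx ε hε0
  have hsub : excSet g x (max (g y) (g z)) ⊆ Icc y z := by
    intro u hu
    refine ⟨le_of_not_gt fun h => ?_, le_of_not_gt fun h => ?_⟩
    · exact (hu.2 y (mem_uIcc.2 (.inl ⟨h.le, hy.2.le⟩))).not_ge (le_max_left _ _)
    · exact (hu.2 z (mem_uIcc.2 (.inr ⟨hz.1.le, h.le⟩))).not_ge (le_max_right _ _)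
  have hlen : lebI.real (excSet g x (max (g y) (g z))) ≤ δ := by
    refine (measureReal_mono hsub).trans ?_
    rw [lebI_real_Icc (by linarith [hy.1]) (by linarith [hy.2, hz.1]) (by linarith [hz.2])]
    linarith [hy.1, hz.2]
  refine Filter.mem_of_superset ?_ (excSet_subset_smallExcSet hlen)
  have hc : ContinuousAt g x := hg.cont.continuousAt (Icc_mem_nhds hx01.1 hx01.2)
  obtain ⟨r, hr, hball⟩ := Metric.mem_nhds_iff.1 <|
    (hc.eventually (lt_mem_nhds (max_lt hyg hzg))).and (Icc_mem_nhds hx01.1 hx01.2)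
  refine Filter.mem_of_superset (Metric.ball_mem_nhds x hr) fun u hu => ⟨(hball hu).2, ?_⟩
  intro v hv
  refine (hball ?_).1
  have hconn : (Metric.ball x r).OrdConnected := by
    rw [Real.ball_eq_Ioo]; exact ordConnected_Ioo
  exact hconn.uIcc_subset hu (Metric.mem_ball_self hr) hv

lemma pairwiseDisjoint_smallExcSet (g : ℝ → ℝ) (δ : ℝ) :
    (smallExcSet g δ '' Icc 0 1).PairwiseDisjoint id := by
  rintro _ ⟨x, hx, rfl⟩ _ ⟨y, hy, rfl⟩ hne
  refine disjoint_left.2 fun z hzx hzy => hne ?_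
  exact (smallExcSet_eq_of_mem hx hzx).symm.trans (smallExcSet_eq_of_mem hy hzy)

lemma ediam_closure_image_smallExcSet_le (b : ℕ → ℝ) (s : ℕ → Bool) (hx : x ∈ Icc (0:ℝ) 1)
    {δ : ℝ} :
    Metric.ediam (closure ((fun t => planePt t (phi g b s t)) '' smallExcSet g δ x)) ≤
      ENNReal.ofReal √2 * min (ENNReal.ofReal δ) (lebI (smallExcSet g δ x)) := by
  rw [Metric.ediam_closure]
  refine Metric.ediam_le ?_
  rintro _ ⟨y, hy, rfl⟩ _ ⟨z, hz, rfl⟩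
  obtain ⟨h, hyh, hzh, hh⟩ := exists_mem_excSet_of_mem_smallExcSet hy hz
  rw [edist_dist]
  refine (ENNReal.ofReal_le_ofReal (dist_planePt_le (abs_sub_le_of_mem_excSet hyh hzh)
    (abs_phi_sub_le hx hyh hzh))).trans ?_
  rw [ENNReal.ofReal_mul (by positivity)]
  gcongr
  refine le_min (ENNReal.ofReal_le_ofReal hh) ?_
  rw [ofReal_measureReal]
  exact measure_mono (excSet_subset_smallExcSet hh)

end Leaves

section Support

variable {g : ℝ → ℝ} {b : ℕ → ℝ} {s : ℕ → Bool}

lemma measurable_planePt_phi (g : ℝ → ℝ) (b : ℕ → ℝ) (s : ℕ → Bool) :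
    Measurable fun t => planePt t (phi g b s t) := by
  refine (WithLp.measurable_toLp 2 _).comp (measurable_pi_iff.2 fun i => ?_)
  fin_cases i
  · exact measurable_id
  · exact measurable_phi g b s

lemma exists_planePt_mem_of_mem_mSupport {z : EuclideanSpace ℝ (Fin 2)}
    (hz : z ∈ mSupport (permutonE g b s)) {U : Set (EuclideanSpace ℝ (Fin 2))} (hU : IsOpen U)
    (hzU : z ∈ U) (c : ℝ) : ∃ t ∈ Icc (0:ℝ) 1, t ≠ c ∧ planePt t (phi g b s t) ∈ U := by
  by_contra! hcon
  refine hz U hU hzU ?_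
  rw [permutonE, Measure.map_apply (measurable_planePt_phi g b s) hU.measurableSet,
    Measure.restrict_apply (measurable_planePt_phi g b s hU.measurableSet)]
  refine measure_mono_null (fun t ht => ?_) (Real.volume_singleton (a := c))
  by_contra htc
  exact hcon t ht.2 htc ht.1

lemma mem_Icc_of_mem_mSupport {z : EuclideanSpace ℝ (Fin 2)}
    (hz : z ∈ mSupport (permutonE g b s)) : z 0 ∈ Icc (0:ℝ) 1 := by
  by_contra h
  obtain ⟨t, ht, -, htU⟩ := exists_planePt_mem_of_mem_mSupport hz
    (U := (fun w : EuclideanSpace ℝ (Fin 2) => w 0) ⁻¹' (Icc 0 1)ᶜ)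
    (isClosed_Icc.isOpen_compl.preimage (by fun_prop)) h 0
  exact htU ht

lemma abs_apply_zero_sub_le (z w : EuclideanSpace ℝ (Fin 2)) : |z 0 - w 0| ≤ dist z w := by
  have := PiLp.norm_apply_le (z - w) 0
  rwa [← dist_eq_norm] at this

lemma mem_closure_spine_of_mem_mSupport (hg : IsCRT g) {z : EuclideanSpace ℝ (Fin 2)}
    (hz : z ∈ mSupport (permutonE g b s)) (hnl : ¬ NotOneSidedMin g (z 0)) :
    ∃ p : ℚ, (p : ℝ) ∈ Icc (0:ℝ) 1 ∧ z ∈ closure (spine g b s p) := by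
  obtain ⟨p, p', hp, hp', H⟩ :=
    exists_near_spine_of_not_notOneSidedMin hg b s (mem_Icc_of_mem_mSupport hz) hnl
  suffices h : z ∈ closure (spine g b s p ∪ spine g b s p') by
    rw [closure_union] at h
    exact h.elim (fun h => ⟨p, hp, h⟩) fun h => ⟨p', hp', h⟩
  refine Metric.mem_closure_iff.2 fun ε hε => ?_
  obtain ⟨δ, hδ, H⟩ := H (ε / 2) (by linarith)
  obtain ⟨t, ht, htz, htU⟩ := exists_planePt_mem_of_mem_mSupport hz Metric.isOpen_ball
    (Metric.mem_ball_self (lt_min hδ (half_pos hε))) (z 0)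
  rw [Metric.mem_ball, lt_min_iff] at htU
  obtain ⟨w, hw, hwt⟩ := H t ht htz ((abs_apply_zero_sub_le _ z).trans_lt htU.1)
  refine ⟨w, hw, (dist_triangle_left z w (planePt t (phi g b s t))).trans_lt ?_⟩
  linarith [htU.2]

lemma mem_closure_of_mem_mSupport {z : EuclideanSpace ℝ (Fin 2)}
    (hz : z ∈ mSupport (permutonE g b s)) {A : Set ℝ} (hA : A ∈ nhds (z 0)) :
    z ∈ closure ((fun t => planePt t (phi g b s t)) '' A) := by
  obtain ⟨δ, hδ, hball⟩ := Metric.mem_nhds_iff.1 hA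
  refine Metric.mem_closure_iff.2 fun ε hε => ?_
  obtain ⟨t, -, -, htU⟩ := exists_planePt_mem_of_mem_mSupport hz Metric.isOpen_ball
    (Metric.mem_ball_self (lt_min hδ hε)) (z 0)
  rw [Metric.mem_ball, lt_min_iff] at htU
  refine ⟨planePt t (phi g b s t), mem_image_of_mem _ (hball ?_), (dist_comm _ _).trans_lt htU.2⟩
  exact (abs_apply_zero_sub_le (planePt t (phi g b s t)) z).trans_lt htU.1

lemma hausdorffMeasure_mSupport_leaves_le (hg : IsCRT g) (b : ℕ → ℝ) (s : ℕ → Bool) :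
    μH[1] {z ∈ mSupport (permutonE g b s) | NotOneSidedMin g (z 0)} ≤ ENNReal.ofReal √2 := by
  let δ : ℕ → ℝ := fun n => 1 / ((n : ℝ) + 1)
  have hδ : ∀ n, 0 < δ n := fun n => Nat.one_div_pos_of_nat
  let F : ℕ → Set (Set ℝ) := fun n => smallExcSet g (δ n) '' {x | NotOneSidedMin g x}
  have hI : ∀ {x}, NotOneSidedMin g x → x ∈ Icc (0:ℝ) 1 := fun hx => Ioo_subset_Icc_self hx.1
  have hdisj : ∀ n, (F n).PairwiseDisjoint id := fun n =>
    (pairwiseDisjoint_smallExcSet g (δ n)).subset (image_mono fun x hx => hI hx)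
  have hcount : ∀ n, (F n).Countable := fun n => by
    refine (hdisj n).countable_of_nonempty_interior ?_
    rintro _ ⟨x, hx, rfl⟩
    exact ⟨x, mem_interior_iff_mem_nhds.2 (hx.smallExcSet_mem_nhds hg (hδ n))⟩
  have : ∀ n, Countable (F n) := fun n => (hcount n).to_subtype
  have hdiam : ∀ n, ∀ A : F n,
      Metric.ediam (closure ((fun t => planePt t (phi g b s t)) '' (A : Set ℝ))) ≤
        ENNReal.ofReal √2 * min (ENNReal.ofReal (δ n)) (lebI A) := by
    rintro n ⟨_, x, hx, rfl⟩
    exact ediam_closure_image_smallExcSet_le b s (hI hx)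
  refine (Measure.hausdorffMeasure_le_liminf_tsum 1 _ (l := Filter.atTop)
    (fun n => ENNReal.ofReal √2 * ENNReal.ofReal (δ n)) ?_
    (fun n (A : F n) => closure ((fun t => planePt t (phi g b s t)) '' (A : Set ℝ)))
    (.of_forall fun n A => (hdiam n A).trans (by gcongr; exact min_le_left _ _))
    (.of_forall fun n z hz => ?_)).trans ?_
  · have h := ENNReal.tendsto_ofReal (tendsto_one_div_add_atTop_nhds_zero_nat (𝕜 := ℝ))
    have h' := ENNReal.Tendsto.const_mul (a := ENNReal.ofReal √2) h (.inr ENNReal.ofReal_ne_top)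
    simpa [δ] using h'
  · exact mem_iUnion.2 ⟨⟨_, z 0, hz.2, rfl⟩,
      mem_closure_of_mem_mSupport hz.1 (hz.2.smallExcSet_mem_nhds hg (hδ n))⟩
  · refine Filter.liminf_le_of_le (by isBoundedDefault) fun c hc => ?_
    obtain ⟨n, hn⟩ := hc.exists
    refine hn.trans ?_
    calc ∑' A : F n, Metric.ediam
          (closure ((fun t => planePt t (phi g b s t)) '' (A : Set ℝ))) ^ (1:ℝ)
        ≤ ∑' A : F n, ENNReal.ofReal √2 * lebI A := by
          refine ENNReal.tsum_le_tsum fun A => ?_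
          rw [ENNReal.rpow_one]
          exact (hdiam n A).trans (by gcongr; exact min_le_right _ _)
      _ = ENNReal.ofReal √2 * lebI (⋃₀ F n) := by
          rw [ENNReal.tsum_mul_left, measure_sUnion (hcount n) (hdisj n)]
          rintro _ ⟨x, -, rfl⟩
          exact measurableSet_smallExcSet g _ x
      _ ≤ ENNReal.ofReal √2 * 1 := by
          gcongr
          refine (measure_mono (subset_univ _)).trans ?_
          simp
      _ = ENNReal.ofReal √2 := mul_one _

lemma hausdorffMeasure_mSupport_le (hg : IsCRT g) (hb : IsEnum g b) (s : ℕ → Bool) :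
    μH[1] (mSupport (permutonE g b s)) ≤ ENNReal.ofReal √2 := by
  have hnull : μH[1] (⋃ p : {p : ℚ // (p : ℝ) ∈ Icc (0:ℝ) 1}, closure (spine g b s p)) = 0 :=
    measure_iUnion_null fun p => hausdorffMeasure_closure_spine hg hb s p.2
  have hsub : mSupport (permutonE g b s) ⊆
      {z ∈ mSupport (permutonE g b s) | NotOneSidedMin g (z 0)} ∪
        ⋃ p : {p : ℚ // (p : ℝ) ∈ Icc (0:ℝ) 1}, closure (spine g b s p) := by
    intro z hz
    by_cases hl : NotOneSidedMin g (z 0)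
    · exact .inl ⟨hz, hl⟩
    · obtain ⟨p, hp, hzp⟩ := mem_closure_spine_of_mem_mSupport hg hz hl
      exact .inr (mem_iUnion.2 ⟨⟨p, hp⟩, hzp⟩)
  refine (measure_mono hsub).trans ((measure_union_le _ _).trans ?_)
  rw [hnull, add_zero]
  exact hausdorffMeasure_mSupport_leaves_le hg b s

lemma permutonE_compl_mSupport (g : ℝ → ℝ) (b : ℕ → ℝ) (s : ℕ → Bool) :
    permutonE g b s (mSupport (permutonE g b s))ᶜ = 0 := by
  refine measure_null_of_locally_null _ fun z hz => ?_
  simp only [mSupport, mem_compl_iff, mem_ofPred_eq, not_forall, not_not] at hz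
  obtain ⟨U, hU, hzU, h0⟩ := hz
  exact ⟨U, mem_nhdsWithin_of_mem_nhds (hU.mem_nhds hzU), h0⟩

lemma one_le_hausdorffMeasure_mSupport (g : ℝ → ℝ) (b : ℕ → ℝ) (s : ℕ → Bool) :
    1 ≤ μH[1] (mSupport (permutonE g b s)) := by
  have hproj : LipschitzWith 1 fun z : EuclideanSpace ℝ (Fin 2) => z 0 :=
    LipschitzWith.of_dist_le_mul fun z w => by
      simpa [Real.dist_eq] using abs_apply_zero_sub_le z w
  have hle := hproj.hausdorffMeasure_image_le zero_le_one (mSupport (permutonE g b s))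
  rw [hausdorffMeasure_real, ENNReal.coe_one, ENNReal.one_rpow, one_mul] at hle
  refine le_trans ?_ hle
  have hae : ∀ᵐ t ∂lebI, planePt t (phi g b s t) ∈ mSupport (permutonE g b s) :=
    ae_of_ae_map (measurable_planePt_phi g b s).aemeasurable (permutonE_compl_mSupport g b s)
  calc (1 : ENNReal) = lebI univ := by simp
    _ ≤ lebI ((fun z : EuclideanSpace ℝ (Fin 2) => z 0) '' mSupport (permutonE g b s)) := by
        refine measure_mono_ae ?_
        filter_upwards [hae] with t ht _
        exact ⟨_, ht, rfl⟩
    _ ≤ volume ((fun z : EuclideanSpace ℝ (Fin 2) => z 0) '' mSupport (permutonE g b s)) :=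
        Measure.restrict_apply_le _ _

end Support

/-- The support of `μ_{g,s}` has Hausdorff dimension `1`, and `1`-dimensional
Hausdorff measure at most `√2`. -/
theorem stmt6 (g : ℝ → ℝ) (hg : IsCRT g) (b : ℕ → ℝ) (hb : IsEnum g b) (s : ℕ → Bool) :
    dimH (mSupport (permutonE g b s)) = 1 ∧
    μH[1] (mSupport (permutonE g b s)) ≤ ENNReal.ofReal (Real.sqrt 2) := by
  have hle := hausdorffMeasure_mSupport_le hg hb s
  refine ⟨?_, hle⟩
  have hne : μH[((1 : NNReal) : ℝ)] (mSupport (permutonE g b s)) ≠ 0 :=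
    (one_pos.trans_le (one_le_hausdorffMeasure_mSupport g b s)).ne'
  exact dimH_of_hausdorffMeasure_ne_zero_ne_top hne (hle.trans_lt ENNReal.ofReal_lt_top).ne

end
end

section
/- Let (g,s) be a signed excursion satisfying property (A), φ = φ_{g,s} and f = f_{g,s}. Then g = f ∘ φ, and φ is an isometry from ([0,1], d_g) to ([0,1], d_f), where d_h(x,y) = h(x) + h(y) − 2·min_{[x∧y, x∨y]} h; equivalently, for all x < y, min_{[x,y]} g = min_{[φ(x),φ(y)]} f. -/
open MeasureTheory Set

noncomputable section

/-- `[a, c]` is the maximal interval around the strict local minimum `β` of `g`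
on which `g` stays above `g β`. -/
structure IsValley (g : ℝ → ℝ) (a β c : ℝ) : Prop where
  left_pos : 0 < a
  left_lt : a < β
  lt_right : β < c
  right_lt : c < 1
  left_eq : g a = g β
  right_eq : g c = g β
  lt_of_left : ∀ u ∈ Ioo a β, g β < g u
  lt_of_right : ∀ u ∈ Ioo β c, g β < g u
  exists_left : ∀ u, 0 ≤ u → u < a → ∃ w ∈ Ico u a, g w < g β
  exists_right : ∀ u, c < u → u ≤ 1 → ∃ w ∈ Ioc c u, g w < g β

namespace IsCRT

variable {g : ℝ → ℝ}

theorem _root_.IsInnerLocalMin.of_Ioo {p u v : ℝ} (hu : 0 ≤ u) (hv : v ≤ 1)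
    (hp : p ∈ Ioo u v) (h : ∀ x ∈ Ioo u v, g p ≤ g x) : IsInnerLocalMin g p := by
  refine ⟨⟨hu.trans_lt hp.1, hp.2.trans_le hv⟩, min (p - u) (v - p),
    lt_min (sub_pos.2 hp.1) (sub_pos.2 hp.2), fun x hx => h x ⟨?_, ?_⟩⟩
  · have := min_le_left (p - u) (v - p)
    linarith [hx.1]
  · have := min_le_right (p - u) (v - p)
    linarith [hx.2]

theorem isStrictLocalMin (hg : IsCRT g) {p : ℝ} (hp : IsInnerLocalMin g p) :
    IsStrictLocalMin g p := by
  obtain ⟨h01, ε, hε, h⟩ := hp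
  refine ⟨h01, min ε (min p (1 - p)),
    lt_min hε (lt_min h01.1 (sub_pos.2 h01.2)), fun x hx hne => ?_⟩
  have h1 := min_le_left ε (min p (1 - p))
  have h2 := (min_le_right ε (min p (1 - p))).trans (min_le_left _ _)
  have h3 := (min_le_right ε (min p (1 - p))).trans (min_le_right _ _)
  have hxε : x ∈ Ioo (p - ε) (p + ε) := ⟨by linarith [hx.1], by linarith [hx.2]⟩
  refine lt_of_le_of_ne (h x hxε) fun heq => hne ?_
  refine hg.distinct x p ⟨⟨by linarith [hx.1], by linarith [hx.2]⟩,
    min (x - (p - ε)) (p + ε - x), lt_min (sub_pos.2 hxε.1) (sub_pos.2 hxε.2),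
    fun y hy => ?_⟩ ⟨h01, ε, hε, h⟩ heq.symm
  rw [← heq]
  have h4 := min_le_left (x - (p - ε)) (p + ε - x)
  have h5 := min_le_right (x - (p - ε)) (p + ε - x)
  exact h y ⟨by linarith [hy.1], by linarith [hy.2]⟩

theorem _root_.IsStrictLocalMin.isInnerLocalMin {p : ℝ} (hp : IsStrictLocalMin g p) :
    IsInnerLocalMin g p := by
  obtain ⟨h01, ε, hε, h⟩ := hp
  refine ⟨h01, ε, hε, fun x hx => ?_⟩
  by_cases hxp : x = p
  · rw [hxp]
  · exact (h x hx hxp).le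

theorem reflect_innerLocalMin {p : ℝ} (hp : IsInnerLocalMin g p) :
    IsInnerLocalMin (fun x => g (1 - x)) (1 - p) := by
  obtain ⟨h01, ε, hε, h⟩ := hp
  refine ⟨⟨by linarith [h01.2], by linarith [h01.1]⟩, ε, hε, fun x hx => ?_⟩
  simp only [sub_sub_cancel]
  exact h _ ⟨by linarith [hx.2], by linarith [hx.1]⟩

theorem left_valley (hg : IsCRT g) {β : ℝ} (hβ : IsStrictLocalMin g β) :
    0 < aPt g β ∧ aPt g β < β ∧ IsGreatest {t | t < β ∧ g t = g β} (aPt g β) ∧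
    (∀ u ∈ Ioo (aPt g β) β, g β < g u) ∧
      ∀ u, 0 ≤ u → u < aPt g β → ∃ w ∈ Ico u (aPt g β), g w < g β := by
  have hin := hβ.isInnerLocalMin
  obtain ⟨h01, ε, hε, h⟩ := hβ
  have hpos : 0 < g β := hg.pos β h01
  obtain ⟨q, hq1, hq2⟩ := exists_between (max_lt h01.1 (sub_lt_self β hε))
  have hq0 : 0 < q := (le_max_left _ _).trans_lt hq1
  have hqε : β - ε < q := (le_max_right _ _).trans_lt hq1
  have hstr : ∀ x, q ≤ x → x < β → g β < g x := fun x h1 h2 =>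
    h x ⟨by linarith, by linarith⟩ h2.ne
  have hsub : Icc 0 q ⊆ Icc (0 : ℝ) 1 := Icc_subset_Icc_right (by linarith [h01.2])
  have hK : IsCompact {t ∈ Icc (0 : ℝ) q | g t = g β} := by
    have := (hg.cont.mono hsub).preimage_isClosed_of_isClosed isClosed_Icc
      (isClosed_singleton (x := g β))
    exact isCompact_Icc.of_isClosed_subset this (fun x hx => hx.1)
  have hne : {t ∈ Icc (0 : ℝ) q | g t = g β}.Nonempty := by
    obtain ⟨t, ht, hgt⟩ := intermediate_value_Icc hq0.le (hg.cont.mono hsub)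
      (show g β ∈ Icc (g 0) (g q) from ⟨by rw [hg.zero0]; exact hpos.le, (hstr q le_rfl hq2).le⟩)
    exact ⟨t, ht, hgt⟩
  obtain ⟨a, ⟨haq, hga⟩, hmax⟩ := hK.exists_isGreatest hne
  have hgr : IsGreatest {t | t < β ∧ g t = g β} a := by
    refine ⟨⟨haq.2.trans_lt hq2, hga⟩, fun t ht => ?_⟩
    by_cases htq : q ≤ t
    · exact absurd ht.2 (hstr t htq ht.1).ne'
    · by_cases ht0 : 0 ≤ t
      · exact hmax ⟨⟨ht0, (not_le.1 htq).le⟩, ht.2⟩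
      · exact (not_le.1 ht0).le.trans haq.1
  have haP : aPt g β = a := hgr.csSup_eq
  rw [haP]
  have haβ : a < β := haq.2.trans_lt hq2
  have ha0 : 0 < a := by
    refine lt_of_le_of_ne haq.1 fun h0 => ?_
    rw [← h0, hg.zero0] at hga
    exact hpos.ne hga
  have hgt : ∀ u ∈ Ioo a β, g β < g u := by
    intro u hu
    by_contra! hle
    by_cases huq : q ≤ u
    · exact (hstr u huq hu.2).not_ge hle
    · push Not at huq
      obtain ⟨t, ht, hgt⟩ := intermediate_value_Icc huq.le
        (hg.cont.mono fun x hx => hsub ⟨by linarith [hu.1, hx.1], hx.2⟩)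
        (show g β ∈ Icc (g u) (g q) from ⟨hle, (hstr q le_rfl hq2).le⟩)
      have := hmax ⟨⟨by linarith [hu.1, ht.1], ht.2⟩, hgt⟩
      linarith [hu.1, ht.1]
  refine ⟨ha0, haβ, hgr, hgt, fun u hu0 hua => ?_⟩
  by_contra! hcon
  refine haβ.ne (hg.distinct a β ?_ hin hga)
  refine IsInnerLocalMin.of_Ioo hu0 h01.2.le ⟨hua, haβ⟩ fun x hx => ?_
  rw [hga]
  rcases lt_trichotomy x a with h1 | h1 | h1
  · exact hcon x ⟨hx.1.le, h1⟩
  · rw [h1, hga]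
  · exact (hgt x ⟨h1, hx.2⟩).le

/-- The reflection of a CRT excursion is a CRT excursion. -/
theorem reflect (hg : IsCRT g) : IsCRT (fun x => g (1 - x)) where
  cont := hg.cont.comp (by fun_prop) fun x hx => ⟨by linarith [hx.2], by linarith [hx.1]⟩
  nonneg t ht := hg.nonneg _ ⟨by linarith [ht.2], by linarith [ht.1]⟩
  pos t ht := hg.pos _ ⟨by linarith [ht.2], by linarith [ht.1]⟩
  zero0 := by simpa using hg.zero1
  zero1 := by simpa using hg.zero0
  dense_min x hx := by
    have h := hg.dense_min (1 - x) ⟨by linarith [hx.2], by linarith [hx.1]⟩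
    rw [Metric.mem_closure_iff] at h ⊢
    intro ε hε
    obtain ⟨p, hp, hd⟩ := h ε hε
    refine ⟨1 - p, reflect_innerLocalMin hp, ?_⟩
    rw [Real.dist_eq, abs_sub_comm] at hd ⊢
    rwa [show 1 - p - x = -(p - (1 - x)) by ring, abs_neg]
  distinct p p' hp hp' h := by
    have h1 := reflect_innerLocalMin hp
    have h2 := reflect_innerLocalMin hp'
    simp only [sub_sub_cancel] at h1 h2
    linarith [hg.distinct _ _ h1 h2 h]
  leaves_full := by
    have hset : {x | NotOneSidedMin (fun x => g (1 - x)) x} =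
        (fun x => 1 - x) ⁻¹' {x | NotOneSidedMin g x} := by
      ext x
      simp only [NotOneSidedMin, mem_ofPred_eq, mem_preimage]
      refine and_congr ⟨fun h => ⟨by linarith [h.2], by linarith [h.1]⟩,
        fun h => ⟨by linarith [h.2], by linarith [h.1]⟩⟩ (forall₂_congr fun ε hε => ?_)
      rw [and_comm]
      constructor
      · rintro ⟨⟨u, hu, h⟩, v, hv, h'⟩
        exact ⟨⟨1 - u, ⟨by linarith [hu.2], by linarith [hu.1]⟩, h⟩,
          1 - v, ⟨by linarith [hv.2], by linarith [hv.1]⟩, h'⟩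
      · rintro ⟨⟨u, hu, h⟩, v, hv, h'⟩
        exact ⟨⟨1 - u, ⟨by linarith [hu.2], by linarith [hu.1]⟩, by simpa using h⟩,
          1 - v, ⟨by linarith [hv.2], by linarith [hv.1]⟩, by simpa using h'⟩
    rw [hset, (Measure.measurePreserving_sub_left volume (1 : ℝ)).measure_preimage_emb
      (MeasurableEquiv.subLeft (1 : ℝ)).measurableEmbedding]
    exact hg.leaves_full

theorem isValley (hg : IsCRT g) {β : ℝ} (hβ : IsStrictLocalMin g β) :
    IsValley g (aPt g β) β (cPt g β) := by
  obtain ⟨h1, h2, h3, h4, h5⟩ := hg.left_valley hβ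
  obtain ⟨r1, r2, r3, r4, r5⟩ := hg.reflect.left_valley
    (hg.reflect.isStrictLocalMin (reflect_innerLocalMin hβ.isInnerLocalMin))
  set a := aPt (fun x => g (1 - x)) (1 - β)
  have hl : IsLeast {t | β < t ∧ g t = g β} (1 - a) := by
    refine ⟨⟨by linarith, by simpa using r3.1.2⟩, fun t ht => ?_⟩
    have : 1 - t ≤ a := r3.2 ⟨by linarith [ht.1], by simpa using ht.2⟩
    linarith
  have hc : cPt g β = 1 - a := hl.csInf_eq
  rw [hc]
  simp only [sub_sub_cancel] at r4 r5
  refine ⟨h1, h2, by linarith, by linarith, h3.1.2, hl.1.2, h4, fun u hu => ?_, h5,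
    fun u hu hu1 => ?_⟩
  · simpa using r4 (1 - u) ⟨by linarith [hu.2], by linarith [hu.1]⟩
  · obtain ⟨w, hw, hlt⟩ := r5 (1 - u) (by linarith) (by linarith)
    exact ⟨1 - w, ⟨by linarith [hw.2], by linarith [hw.1]⟩, hlt⟩

theorem exists_valley (hg : IsCRT g) {t y z : ℝ} (ht : t ∈ Ioo (0 : ℝ) 1) (hy : 0 ≤ y)
    (hyz : y < z) (hz : z ≤ g t) :
    ∃ β, IsStrictLocalMin g β ∧ y < g β ∧ g β < z ∧ t ∈ Icc (aPt g β) (cPt g β) := by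
  have hsub : Icc 0 t ⊆ Icc (0 : ℝ) 1 := Icc_subset_Icc_right ht.2.le
  have hK : IsCompact {u ∈ Icc (0 : ℝ) t | g u ∈ Iic y} := by
    have := (hg.cont.mono hsub).preimage_isClosed_of_isClosed isClosed_Icc
      (isClosed_Iic (a := y))
    exact isCompact_Icc.of_isClosed_subset this (fun x hx => hx.1)
  obtain ⟨l, ⟨hl, hly⟩, hmax⟩ := hK.exists_isGreatest
    ⟨0, ⟨le_rfl, ht.1.le⟩, by simpa [hg.zero0] using hy⟩
  have hly : g l ≤ y := hly
  have hlt : l < t := lt_of_le_of_ne hl.2 fun h => by rw [h] at hly; linarith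
  have hgy : ∀ u, l < u → u ≤ t → y < g u := fun u h1 h2 => by
    by_contra! h
    exact (hmax ⟨⟨hl.1.trans h1.le, h2⟩, h⟩).not_gt h1
  obtain ⟨δ, hδ, hδ'⟩ : ∃ δ > 0, ∀ u ∈ Icc (0 : ℝ) 1, |u - l| < δ → g u < z := by
    have := Metric.continuousWithinAt_iff.1 (hg.cont l (hsub hl)) (z - g l) (by linarith)
    obtain ⟨δ, hδ, h⟩ := this
    refine ⟨δ, hδ, fun u hu hd => ?_⟩
    have := (abs_lt.1 (h hu hd)).2
    linarith
  obtain ⟨m, hm1, hm2⟩ := exists_between (lt_min hlt (lt_add_of_pos_right l hδ))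
  have hmt := hm2.trans_le (min_le_left _ _)
  have hmδ := hm2.trans_le (min_le_right _ _)
  obtain ⟨β, hβ, hβmin⟩ := mem_closure_iff.1 (hg.dense_min m ⟨by linarith [hl.1], by linarith [ht.2]⟩)
    (Ioo l (min t (l + δ))) isOpen_Ioo ⟨hm1, hm2⟩
  have hβt := hβ.2.trans_le (min_le_left _ _)
  have hβδ := hβ.2.trans_le (min_le_right _ _)
  have hβ0 : 0 < β := hl.1.trans_lt hβ.1
  have hgβ : g β < z := hδ' β ⟨hβ0.le, by linarith [ht.2]⟩
    (abs_lt.2 ⟨by linarith [hβ.1], by linarith⟩)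
  obtain ⟨p, hp, hpmin⟩ := isCompact_Icc.exists_isMinOn (nonempty_Icc.2 hβt.le)
    (hg.cont.mono fun x (hx : x ∈ Icc β t) => hsub ⟨hβ0.le.trans hx.1, hx.2⟩)
  have hpmin : ∀ x ∈ Icc β t, g p ≤ g x := hpmin
  have hpz : g p < z := (hpmin β ⟨le_rfl, hβt.le⟩).trans_lt hgβ
  have hpt : p < t := lt_of_le_of_ne hp.2 fun h => by rw [h] at hpz; linarith
  have hin : IsInnerLocalMin g p := by
    rcases hp.1.eq_or_lt with h | h
    · rwa [← h]
    · exact IsInnerLocalMin.of_Ioo hβ0.le ht.2.le ⟨h, hpt⟩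
        fun x hx => hpmin x ⟨hx.1.le, hx.2.le⟩
  have hst := hg.isStrictLocalMin hin
  have hV := hg.isValley hst
  refine ⟨p, hst, hgy p (hβ.1.trans_le hp.1) hp.2, hpz, (hV.left_lt.trans hpt).le, ?_⟩
  by_contra! hc
  obtain ⟨w, hw, hwlt⟩ := hV.exists_right t hc ht.2.le
  exact hwlt.not_ge (hpmin w ⟨by linarith [hp.1, hw.1, hV.lt_right], hw.2⟩)

end IsCRT

theorem IsValley.le {g : ℝ → ℝ} {a β c u : ℝ} (h : IsValley g a β c) (hu : u ∈ Icc a c) :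
    g β ≤ g u := by
  rcases hu.1.eq_or_lt with h1 | h1
  · rw [← h1, h.left_eq]
  rcases hu.2.eq_or_lt with h2 | h2
  · rw [h2, h.right_eq]
  rcases lt_trichotomy u β with h3 | h3 | h3
  · exact (h.lt_of_left u ⟨h1, h3⟩).le
  · rw [h3]
  · exact (h.lt_of_right u ⟨h3, h2⟩).le

section Mrca

variable {g : ℝ → ℝ} {a β c γ r t t' u : ℝ}

theorem IsMrca.lt_right (h : IsMrca g γ u t) : g γ < g t :=
  lt_of_le_of_ne (h.2.2.2.1 t ⟨h.1.le, le_rfl⟩) fun e =>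
    h.2.1.2.ne' (h.2.2.2.2 t ⟨h.1.le, le_rfl⟩ e.symm)

theorem IsMrca.lt_left (h : IsMrca g γ t u) : g γ < g t :=
  lt_of_le_of_ne (h.2.2.2.1 t ⟨le_rfl, h.1.le⟩) fun e =>
    h.2.1.1.ne (h.2.2.2.2 t ⟨le_rfl, h.1.le⟩ e.symm)

theorem IsMrca.of_mem_valley_right (hV : IsValley g a β c) (hu : 0 ≤ u) (huI : u ∉ Icc a c)
    (ht : t ∈ Icc a c) (ht' : t' ∈ Icc a c) (h : IsMrca g γ u t) : IsMrca g γ u t' := by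
  have hua : u < a := by
    by_contra! hc
    exact huI ⟨hc, h.1.le.trans ht.2⟩
  obtain ⟨w, hw, hwlt⟩ := hV.exists_left u hu hua
  have hγw := h.2.2.2.1 w ⟨hw.1, (hw.2.trans_le ht.1).le⟩
  have hγI : ∀ v ∈ Icc a c, g γ < g v := fun v hv => (hγw.trans_lt hwlt).trans_le (hV.le hv)
  have hγa : γ < a := by
    by_contra! hc
    exact (hγI γ ⟨hc, h.2.1.2.le.trans ht.2⟩).false
  refine ⟨hua.trans_le ht'.1, ⟨h.2.1.1, hγa.trans_le ht'.1⟩, h.2.2.1, fun v hv => ?_,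
    fun v hv e => ?_⟩
  all_goals rcases le_or_gt a v with hav | hav
  · exact (hγI v ⟨hav, hv.2.trans ht'.2⟩).le
  · exact h.2.2.2.1 v ⟨hv.1, (hav.trans_le ht.1).le⟩
  · exact absurd e (hγI v ⟨hav, hv.2.trans ht'.2⟩).ne'
  · exact h.2.2.2.2 v ⟨hv.1, (hav.trans_le ht.1).le⟩ e

theorem IsMrca.of_mem_valley_left (hV : IsValley g a β c) (hu : u ≤ 1) (huI : u ∉ Icc a c)
    (ht : t ∈ Icc a c) (ht' : t' ∈ Icc a c) (h : IsMrca g γ t u) : IsMrca g γ t' u := by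
  have hua : c < u := by
    by_contra! hc
    exact huI ⟨ht.1.trans h.1.le, hc⟩
  obtain ⟨w, hw, hwlt⟩ := hV.exists_right u hua hu
  have hγw := h.2.2.2.1 w ⟨(ht.2.trans_lt hw.1).le, hw.2⟩
  have hγI : ∀ v ∈ Icc a c, g γ < g v := fun v hv => (hγw.trans_lt hwlt).trans_le (hV.le hv)
  have hγa : c < γ := by
    by_contra! hc
    exact (hγI γ ⟨ht.1.trans h.2.1.1.le, hc⟩).false
  refine ⟨ht'.2.trans_lt hua, ⟨ht'.2.trans_lt hγa, h.2.1.2⟩, h.2.2.1, fun v hv => ?_,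
    fun v hv e => ?_⟩
  all_goals rcases le_or_gt v c with hav | hav
  · exact (hγI v ⟨ht'.1.trans hv.1, hav⟩).le
  · exact h.2.2.2.1 v ⟨(ht.2.trans_lt hav).le, hv.2⟩
  · exact absurd e (hγI v ⟨ht'.1.trans hv.1, hav⟩).ne'
  · exact h.2.2.2.2 v ⟨(ht.2.trans_lt hav).le, hv.2⟩ e

theorem IsMrca.of_le_uIcc_right (hr : ∀ v ∈ uIcc t r, g t ≤ g v) (h : IsMrca g γ u t) :
    IsMrca g γ u r := by
  have hγ := h.lt_right
  rcases le_total t r with htr | htr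
  · rw [uIcc_of_le htr] at hr
    refine ⟨h.1.trans_le htr, ⟨h.2.1.1, h.2.1.2.trans_le htr⟩, h.2.2.1, fun v hv => ?_,
      fun v hv e => ?_⟩
    all_goals rcases le_or_gt t v with hv' | hv'
    · exact hγ.le.trans (hr v ⟨hv', hv.2⟩)
    · exact h.2.2.2.1 v ⟨hv.1, hv'.le⟩
    · exact absurd e (hγ.trans_le (hr v ⟨hv', hv.2⟩)).ne'
    · exact h.2.2.2.2 v ⟨hv.1, hv'.le⟩ e
  · rw [uIcc_of_ge htr] at hr
    have hγr : γ < r := by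
      by_contra! hc
      exact (hγ.trans_le (hr γ ⟨hc, h.2.1.2.le⟩)).false
    exact ⟨h.2.1.1.trans hγr, ⟨h.2.1.1, hγr⟩, h.2.2.1,
      fun v hv => h.2.2.2.1 v ⟨hv.1, hv.2.trans htr⟩,
      fun v hv => h.2.2.2.2 v ⟨hv.1, hv.2.trans htr⟩⟩

theorem IsMrca.of_le_uIcc_left (hr : ∀ v ∈ uIcc t r, g t ≤ g v) (h : IsMrca g γ t u) :
    IsMrca g γ r u := by
  have hγ := h.lt_left
  rcases le_total r t with htr | htr
  · rw [uIcc_of_ge htr] at hr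
    refine ⟨htr.trans_lt h.1, ⟨htr.trans_lt h.2.1.1, h.2.1.2⟩, h.2.2.1, fun v hv => ?_,
      fun v hv e => ?_⟩
    all_goals rcases le_or_gt v t with hv' | hv'
    · exact hγ.le.trans (hr v ⟨hv.1, hv'⟩)
    · exact h.2.2.2.1 v ⟨hv'.le, hv.2⟩
    · exact absurd e (hγ.trans_le (hr v ⟨hv.1, hv'⟩)).ne'
    · exact h.2.2.2.2 v ⟨hv'.le, hv.2⟩ e
  · rw [uIcc_of_le htr] at hr
    have hγr : r < γ := by
      by_contra! hc
      exact (hγ.trans_le (hr γ ⟨h.2.1.1.le, hc⟩)).false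
    exact ⟨hγr.trans h.2.1.2, ⟨hγr, h.2.1.2⟩, h.2.2.1,
      fun v hv => h.2.2.2.1 v ⟨htr.trans hv.1, hv.2⟩,
      fun v hv => h.2.2.2.2 v ⟨htr.trans hv.1, hv.2⟩⟩

end Mrca

section Tri

variable {g : ℝ → ℝ} {b : ℕ → ℝ} {s : ℕ → Bool}

theorem IsEnum.isStrictLocalMin (hb : IsEnum g b) (i : ℕ) : IsStrictLocalMin g (b i) :=
  (hb.2 _).2 ⟨i, rfl⟩

theorem IsCRT.valley (hg : IsCRT g) (hb : IsEnum g b) (i : ℕ) :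
    IsValley g (aI g b i) (b i) (cI g b i) :=
  hg.isValley (hb.isStrictLocalMin i)

theorem IsValley.subset_Icc {a β c : ℝ} (h : IsValley g a β c) : Icc a c ⊆ Icc (0 : ℝ) 1 :=
  Icc_subset_Icc h.left_pos.le h.right_lt.le

theorem IsValley.left_mem {a β c : ℝ} (h : IsValley g a β c) : a ∈ Icc a c :=
  ⟨le_rfl, (h.left_lt.trans h.lt_right).le⟩

theorem Tri.of_mem_valley {a β c t t' u : ℝ} (hV : IsValley g a β c) (hu : u ∈ Icc (0 : ℝ) 1)
    (huI : u ∉ Icc a c) (ht : t ∈ Icc a c) (ht' : t' ∈ Icc a c) (h : Tri g b s u t) :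
    Tri g b s u t' := by
  obtain ⟨i, h | h⟩ := h
  · exact ⟨i, Or.inl ⟨h.1.of_mem_valley_right hV hu.1 huI ht ht', h.2⟩⟩
  · exact ⟨i, Or.inr ⟨h.1.of_mem_valley_left hV hu.2 huI ht ht', h.2⟩⟩

theorem Tri.of_le_uIcc {t r u : ℝ} (hr : ∀ v ∈ uIcc t r, g t ≤ g v) (h : Tri g b s u t) :
    Tri g b s u r := by
  obtain ⟨i, h | h⟩ := h
  · exact ⟨i, Or.inl ⟨h.1.of_le_uIcc_right hr, h.2⟩⟩
  · exact ⟨i, Or.inr ⟨h.1.of_le_uIcc_left hr, h.2⟩⟩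

theorem IsValley.not_tri_left {a β c u : ℝ} (hV : IsValley g a β c) (hu : u ∈ Icc a c) :
    ¬ Tri g b s u a := by
  rintro ⟨i, h | h⟩
  · exact (h.1.1.trans_le hu.1).false
  · have h1 := h.1.lt_left
    rw [hV.left_eq] at h1
    exact h1.not_ge (hV.le ⟨h.1.2.1.1.le, h.1.2.1.2.le.trans hu.2⟩)

/-- The lower end of the left (`σ = true`) or right (`σ = false`) half of the `i`-th valley. -/
def lo (g : ℝ → ℝ) (b : ℕ → ℝ) (σ : Bool) (i : ℕ) : ℝ := if σ then aI g b i else b i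

/-- The upper end of the left (`σ = true`) or right (`σ = false`) half of the `i`-th valley. -/
def hi (g : ℝ → ℝ) (b : ℕ → ℝ) (σ : Bool) (i : ℕ) : ℝ := if σ then b i else cI g b i

theorem bI'_eq (i : ℕ) : bI' g b s i = aI' g b s i + (hi g b (s i) i - lo g b (s i) i) := by
  unfold bI' lo hi
  cases s i <;> rfl

theorem hi_sub_lo_add (σ : Bool) (i : ℕ) :
    hi g b σ i - lo g b σ i + (hi g b (!σ) i - lo g b (!σ) i) = cI g b i - aI g b i := by
  cases σ <;> simp [lo, hi]

theorem IsCRT.lo_lt_hi (hg : IsCRT g) (hb : IsEnum g b) (σ : Bool) (i : ℕ) :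
    lo g b σ i < hi g b σ i := by
  have hV := hg.valley hb i
  cases σ
  · exact hV.lt_right
  · exact hV.left_lt

theorem IsCRT.half_subset (hg : IsCRT g) (hb : IsEnum g b) (σ : Bool) (i : ℕ) :
    Icc (lo g b σ i) (hi g b σ i) ⊆ Icc (aI g b i) (cI g b i) := by
  have hV := hg.valley hb i
  cases σ
  · exact Icc_subset_Icc_left hV.left_lt.le
  · exact Icc_subset_Icc_right hV.lt_right.le

theorem IsCRT.mem_half (hg : IsCRT g) (hb : IsEnum g b) {i : ℕ} {t : ℝ}
    (ht : t ∈ Icc (aI g b i) (cI g b i)) (h : g (b i) < g t) :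
    ∃ σ, t ∈ Ioo (lo g b σ i) (hi g b σ i) := by
  have hV := hg.valley hb i
  have h1 : aI g b i < t := lt_of_le_of_ne ht.1 fun e => by rw [← e, hV.left_eq] at h; exact h.false
  have h2 : t < cI g b i := lt_of_le_of_ne ht.2 fun e => by rw [e, hV.right_eq] at h; exact h.false
  rcases lt_trichotomy t (b i) with h3 | h3 | h3
  · exact ⟨true, h1, h3⟩
  · rw [h3] at h
    exact absurd h (lt_irrefl _)
  · exact ⟨false, h3, h2⟩

/-- A valley meeting an open half of a lower valley is contained in that half. -/
theorem IsCRT.valley_subset_half (hg : IsCRT g) (hb : IsEnum g b) {σ : Bool} {i j : ℕ} {t : ℝ}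
    (hij : g (b i) < g (b j)) (ht : t ∈ Ioo (lo g b σ i) (hi g b σ i))
    (htj : t ∈ Icc (aI g b j) (cI g b j)) :
    Icc (aI g b j) (cI g b j) ⊆ Ioo (lo g b σ i) (hi g b σ i) := by
  have hV := hg.valley hb i
  have hW := hg.valley hb j
  have hlo : g (lo g b σ i) = g (b i) := by
    cases σ
    · rfl
    · exact hV.left_eq
  have hhi : g (hi g b σ i) = g (b i) := by
    cases σ
    · exact hV.right_eq
    · rfl
  intro u hu
  constructor
  · by_contra! hc
    have := hW.le (u := lo g b σ i) ⟨hu.1.trans hc, ht.1.le.trans htj.2⟩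
    linarith
  · by_contra! hc
    have := hW.le (u := hi g b σ i) ⟨htj.1.trans ht.2.le, hc.trans hu.2⟩
    linarith

/-- Points in opposite halves of a valley are compared by the sign of that valley. -/
theorem IsCRT.isMrca_of_halves (hg : IsCRT g) (hb : IsEnum g b) {i : ℕ} {t u : ℝ}
    (ht : t ∈ Ioo (aI g b i) (b i)) (hu : u ∈ Ioo (b i) (cI g b i)) : IsMrca g (b i) t u := by
  have hV := hg.valley hb i
  refine ⟨ht.2.trans hu.1, ⟨ht.2, hu.1⟩, hb.isStrictLocalMin i,
    fun v hv => hV.le ⟨ht.1.le.trans hv.1, hv.2.trans hu.2.le⟩, fun v hv e => ?_⟩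
  rcases lt_trichotomy v (b i) with h | h | h
  · exact absurd e (hV.lt_of_left v ⟨ht.1.trans_le hv.1, h⟩).ne'
  · exact h
  · exact absurd e (hV.lt_of_right v ⟨h, hv.2.trans_lt hu.2⟩).ne'

theorem IsCRT.tri_of_halves (hg : IsCRT g) (hb : IsEnum g b) {i : ℕ} {t u : ℝ}
    (ht : t ∈ Ioo (lo g b (!s i) i) (hi g b (!s i) i))
    (hu : u ∈ Ioo (lo g b (s i) i) (hi g b (s i) i)) : Tri g b s u t := by
  refine ⟨i, ?_⟩
  cases h : s i <;> rw [h] at ht hu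
  · exact Or.inr ⟨hg.isMrca_of_halves hb ht hu, rfl⟩
  · exact Or.inl ⟨hg.isMrca_of_halves hb hu ht, rfl⟩

theorem IsCRT.mem_half_of_tri (hg : IsCRT g) (hb : IsEnum g b) {i : ℕ} {t u : ℝ}
    (ht : t ∈ Ioo (lo g b (s i) i) (hi g b (s i) i)) (hu : u ∈ Icc (aI g b i) (cI g b i))
    (h : Tri g b s u t) : u ∈ Icc (lo g b (s i) i) (hi g b (s i) i) := by
  have hV := hg.valley hb i
  obtain ⟨k, h⟩ := h
  have key : ∀ v w, v ∈ Icc (aI g b i) (cI g b i) → w ∈ Icc (aI g b i) (cI g b i) →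
      b i ∈ Icc v w → IsMrca g (b k) v w → k = i := fun v w hv hw hi hm =>
    hb.1 (hm.2.2.2.2 (b i) hi (le_antisymm
      (hV.le ⟨hv.1.trans hm.2.1.1.le, hm.2.1.2.le.trans hw.2⟩) (hm.2.2.2.1 _ hi))).symm
  have htI := hg.half_subset hb _ _ (Ioo_subset_Icc_self ht)
  by_contra hc
  cases hs : s i <;> rw [hs] at ht hc
  · have hub : u < b i := by
      by_contra! h'
      exact hc ⟨h', hu.2⟩
    have htb : b i < t := ht.1
    rcases h with h | h
    · have := key u t hu htI ⟨hub.le, htb.le⟩ h.1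
      rw [← this, h.2] at hs
      exact absurd hs (by decide)
    · exact (h.1.1.trans (hub.trans htb)).false
  · have hub : b i < u := by
      by_contra! h'
      exact hc ⟨hu.1, h'⟩
    have htb : t < b i := ht.2
    rcases h with h | h
    · exact (h.1.1.trans (htb.trans hub)).false
    · have := key t u htI hu ⟨htb.le, hub.le⟩ h.1
      rw [← this, h.2] at hs
      exact absurd hs (by decide)

end Tri

section Phi

variable {g : ℝ → ℝ} {b : ℕ → ℝ} {s : ℕ → Bool}

theorem phi_eq_add_s16 (hg : IsCRT g) (hb : IsEnum g b) {i : ℕ} {t : ℝ}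
    (ht : t ∈ Icc (aI g b i) (cI g b i)) :
    phi g b s t = aI' g b s i + volume.real {u ∈ Icc (aI g b i) (cI g b i) | Tri g b s u t} := by
  have hV := hg.valley hb i
  have hfin : volume {u ∈ Icc (0 : ℝ) 1 | Tri g b s u t} ≠ ⊤ :=
    ((measure_mono fun x hx => hx.1).trans_lt measure_Icc_lt_top).ne
  have h := measureReal_inter_add_sdiff (μ := volume) (s := {u ∈ Icc (0 : ℝ) 1 | Tri g b s u t})
    (measurableSet_Icc (a := aI g b i) (b := cI g b i)) hfin
  have h1 : {u ∈ Icc (0 : ℝ) 1 | Tri g b s u t} ∩ Icc (aI g b i) (cI g b i) =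
      {u ∈ Icc (aI g b i) (cI g b i) | Tri g b s u t} := by
    ext u
    exact ⟨fun hu => ⟨hu.2, hu.1.2⟩, fun hu => ⟨⟨hV.subset_Icc hu.1, hu.2⟩, hu.1⟩⟩
  have h2 : {u ∈ Icc (0 : ℝ) 1 | Tri g b s u t} \ Icc (aI g b i) (cI g b i) =
      {u ∈ Icc (0 : ℝ) 1 | Tri g b s u (aI g b i)} := by
    ext u
    refine ⟨fun hu => ⟨hu.1.1, hu.1.2.of_mem_valley hV hu.1.1 hu.2 ht hV.left_mem⟩, fun hu => ?_⟩
    have huI : u ∉ Icc (aI g b i) (cI g b i) := fun h => hV.not_tri_left h hu.2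
    exact ⟨⟨hu.1, hu.2.of_mem_valley hV hu.1 huI hV.left_mem ht⟩, huI⟩
  rw [h1, h2] at h
  rw [add_comm]
  exact h.symm

theorem volume_real_le_of_subset_Icc {S : Set ℝ} {p q : ℝ} (hpq : p ≤ q) (h : S ⊆ Icc p q) :
    volume.real S ≤ q - p := by
  rw [← Real.volume_real_Icc_of_le hpq]
  exact measureReal_mono h measure_Icc_lt_top.ne

theorem phi_mem (hg : IsCRT g) (hb : IsEnum g b) {i : ℕ} {t : ℝ}
    (ht : t ∈ Icc (aI g b i) (cI g b i)) :
    phi g b s t ∈ Icc (aI' g b s i) (cI' g b s i) := by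
  rw [phi_eq_add_s16 hg hb ht]
  refine ⟨le_add_of_nonneg_right measureReal_nonneg, ?_⟩
  exact add_le_add_right (volume_real_le_of_subset_Icc (ht.1.trans ht.2) fun u hu => hu.1) _

theorem phi_le_bI' (hg : IsCRT g) (hb : IsEnum g b) {i : ℕ} {t : ℝ}
    (ht : t ∈ Ioo (lo g b (s i) i) (hi g b (s i) i)) : phi g b s t ≤ bI' g b s i := by
  have htI := hg.half_subset hb _ _ (Ioo_subset_Icc_self ht)
  rw [phi_eq_add_s16 hg hb htI, bI'_eq]
  exact add_le_add_right (volume_real_le_of_subset_Icc (hg.lo_lt_hi hb _ i).le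
    fun u hu => hg.mem_half_of_tri hb ht hu.1 hu.2) _

theorem bI'_le_phi (hg : IsCRT g) (hb : IsEnum g b) {i : ℕ} {t : ℝ}
    (ht : t ∈ Ioo (lo g b (!s i) i) (hi g b (!s i) i)) : bI' g b s i ≤ phi g b s t := by
  have htI := hg.half_subset hb _ _ (Ioo_subset_Icc_self ht)
  rw [phi_eq_add_s16 hg hb htI, bI'_eq]
  refine add_le_add_right ?_ _
  rw [← Real.volume_real_Ioo_of_le (hg.lo_lt_hi hb _ i).le]
  refine measureReal_mono (fun u hu => ⟨hg.half_subset hb _ _ (Ioo_subset_Icc_self hu),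
    hg.tri_of_halves hb ht hu⟩) ((measure_mono fun x hx => hx.1).trans_lt measure_Icc_lt_top).ne

theorem aI'_lt_bI' (hg : IsCRT g) (hb : IsEnum g b) (i : ℕ) : aI' g b s i < bI' g b s i := by
  rw [bI'_eq]
  linarith [hg.lo_lt_hi hb (s i) i]

theorem bI'_lt_cI' (hg : IsCRT g) (hb : IsEnum g b) (i : ℕ) : bI' g b s i < cI' g b s i := by
  rw [bI'_eq, cI', ← hi_sub_lo_add (s i) i]
  linarith [hg.lo_lt_hi hb (!s i) i]

/-- If `[p, q]` contains the valley `j` and all points of the valley `i` preceding it, then the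
image of the valley `j` ends at most `q - p` after the start of the image of the valley `i`. -/
theorem cI'_le_of_subset (hg : IsCRT g) (hb : IsEnum g b) {i j : ℕ} {p q : ℝ}
    (hji : Icc (aI g b j) (cI g b j) ⊆ Icc (aI g b i) (cI g b i))
    (hjpq : Icc (aI g b j) (cI g b j) ⊆ Icc p q)
    (htri : ∀ u ∈ Icc (aI g b i) (cI g b i), Tri g b s u (aI g b j) → u ∈ Icc p q) :
    cI' g b s j ≤ aI' g b s i + (q - p) := by
  have hW := hg.valley hb j
  have haj := phi_eq_add_s16 (s := s) hg hb (hji hW.left_mem)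
  have hpq : p ≤ q := (hjpq hW.left_mem).1.trans (hjpq hW.left_mem).2
  set S := {u ∈ Icc (aI g b i) (cI g b i) | Tri g b s u (aI g b j)}
  have hS : S ⊆ Icc p q := fun u hu => htri u hu.1 hu.2
  have hd : Disjoint S (Icc (aI g b j) (cI g b j)) :=
    Set.disjoint_left.2 fun u hu hu' => hW.not_tri_left hu' hu.2
  have h := measureReal_union (μ := volume) hd measurableSet_Icc
    ((measure_mono hS).trans_lt measure_Icc_lt_top).ne measure_Icc_lt_top.ne
  have h2 := volume_real_le_of_subset_Icc hpq (union_subset hS hjpq)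
  rw [h, Real.volume_real_Icc_of_le (hW.left_mem.2)] at h2
  have h3 : aI' g b s j = phi g b s (aI g b j) := rfl
  rw [cI', h3, haj]
  linarith

theorem image_subset (hg : IsCRT g) (hb : IsEnum g b) {i j : ℕ}
    (hji : Icc (aI g b j) (cI g b j) ⊆ Icc (aI g b i) (cI g b i)) :
    Icc (aI' g b s j) (cI' g b s j) ⊆ Icc (aI' g b s i) (cI' g b s i) :=
  Icc_subset_Icc (phi_mem hg hb (hji (hg.valley hb j).left_mem)).1
    (cI'_le_of_subset hg hb hji hji fun _ hu _ => hu)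

theorem cI'_le_bI' (hg : IsCRT g) (hb : IsEnum g b) {i j : ℕ}
    (h : Icc (aI g b j) (cI g b j) ⊆ Ioo (lo g b (s i) i) (hi g b (s i) i)) :
    cI' g b s j ≤ bI' g b s i := by
  have h' := h.trans Ioo_subset_Icc_self
  rw [bI'_eq]
  exact cI'_le_of_subset hg hb (h'.trans (hg.half_subset hb _ _)) h' fun u hu hut =>
    hg.mem_half_of_tri hb (h (hg.valley hb j).left_mem) hu hut

theorem bI'_le_aI' (hg : IsCRT g) (hb : IsEnum g b) {i j : ℕ}
    (h : Icc (aI g b j) (cI g b j) ⊆ Ioo (lo g b (!s i) i) (hi g b (!s i) i)) :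
    bI' g b s i ≤ aI' g b s j :=
  bI'_le_phi hg hb (h (hg.valley hb j).left_mem)

theorem phi_le_aI'_or_cI'_le_phi (hg : IsCRT g) (hb : IsEnum g b) {k : ℕ} {t : ℝ}
    (ht : t ∈ Icc (0 : ℝ) 1) (htk : t ∉ Icc (aI g b k) (cI g b k)) :
    phi g b s t ≤ aI' g b s k ∨ cI' g b s k ≤ phi g b s t := by
  have hV := hg.valley hb k
  set a := aI g b k with ha
  have ha01 := hV.subset_Icc hV.left_mem
  have hsub : uIcc t a ⊆ Icc (0 : ℝ) 1 := uIcc_subset_Icc ht ha01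
  obtain ⟨w, hw, hwlt⟩ : ∃ w ∈ uIcc t a, g w < g (b k) := by
    rcases lt_or_ge t a with h | h
    · obtain ⟨w, hw, hlt⟩ := hV.exists_left t ht.1 h
      exact ⟨w, by rw [uIcc_of_le h.le]; exact Ico_subset_Icc_self hw, hlt⟩
    · have hc : cI g b k < t := by
        by_contra! hc
        exact htk ⟨h, hc⟩
      obtain ⟨w, hw, hlt⟩ := hV.exists_right t hc ht.2
      exact ⟨w, by rw [uIcc_of_ge h]; exact ⟨(hV.left_mem.2.trans_lt hw.1).le, hw.2⟩, hlt⟩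
  obtain ⟨p, hp, hpmin⟩ := isCompact_uIcc.exists_isMinOn nonempty_uIcc (hg.cont.mono hsub)
  have hpmin : ∀ v ∈ uIcc t a, g p ≤ g v := hpmin
  have hpk : g p < g (b k) := (hpmin w hw).trans_lt hwlt
  rcases le_or_gt (g t) (g p) with htp | hpt
  · left
    refine measureReal_mono (fun u hu => ⟨hu.1, hu.2.of_le_uIcc fun v hv => ?_⟩)
      ((measure_mono fun x hx => hx.1).trans_lt measure_Icc_lt_top).ne
    exact htp.trans (hpmin v hv)
  have hpa : g p < g a := hpk.trans_eq hV.left_eq.symm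
  have hne : ∀ v, g v = g p → v ≠ t ∧ v ≠ a := fun v hv =>
    ⟨fun e => by rw [← e, hv] at hpt; exact hpt.false,
      fun e => by rw [← e, hv] at hpa; exact hpa.false⟩
  have hmin : ∀ v ∈ uIcc t a, g v = g p → IsInnerLocalMin g v := fun v hv e => by
    refine IsInnerLocalMin.of_Ioo (le_min ht.1 ha01.1) (max_le ht.2 ha01.2) ⟨?_, ?_⟩ fun x hx => ?_
    · refine lt_of_le_of_ne hv.1 fun h => ?_
      rcases min_choice t a with h' | h' <;> rw [h'] at h
      · exact (hne v e).1 h.symm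
      · exact (hne v e).2 h.symm
    · refine lt_of_le_of_ne hv.2 fun h => ?_
      rcases max_choice t a with h' | h' <;> rw [h'] at h
      · exact (hne v e).1 h
      · exact (hne v e).2 h
    · rw [e]
      exact hpmin x (Ioo_subset_Icc_self hx)
  have huniq : ∀ v ∈ uIcc t a, v ≠ p → g p < g v := fun v hv hvp =>
    lt_of_le_of_ne (hpmin v hv) fun e =>
      hvp (hg.distinct v p (hmin v hv e.symm) (hmin p hp rfl) e.symm)
  obtain ⟨l, hl⟩ := (hb.2 p).1 (hg.isStrictLocalMin (hmin p hp rfl))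
  have hW := hg.valley hb l
  rw [hl] at hW
  have hleft : ∀ x y, p ∈ Icc x y → Icc x y ⊆ uIcc t a → x ≠ p → y ≠ p →
      x ∈ Ioo (aI g b l) p ∧ y ∈ Ioo p (cI g b l) := fun x y hxy hsub hx hy => by
    refine ⟨⟨?_, lt_of_le_of_ne hxy.1 hx⟩, lt_of_le_of_ne hxy.2 (Ne.symm hy), ?_⟩
    · by_contra! hc
      exact (huniq _ (hsub ⟨hc, hW.left_lt.le.trans hxy.2⟩) hW.left_lt.ne).ne' hW.left_eq
    · by_contra! hc
      exact (huniq _ (hsub ⟨hxy.1.trans hW.lt_right.le, hc⟩) hW.lt_right.ne').ne' hW.right_eq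
  have hpta := hne p rfl
  have hhalf : ∃ σ, t ∈ Ioo (lo g b σ l) (hi g b σ l) ∧ a ∈ Ioo (lo g b (!σ) l) (hi g b (!σ) l) := by
    rcases le_total t a with h | h
    · rw [uIcc_of_le h] at hp hleft
      obtain ⟨h1, h2⟩ := hleft t a hp Subset.rfl hpta.1.symm hpta.2.symm
      rw [← hl] at h1 h2
      exact ⟨true, h1, h2⟩
    · rw [uIcc_of_ge h] at hp hleft
      obtain ⟨h1, h2⟩ := hleft a t hp Subset.rfl hpta.2.symm hpta.1.symm
      rw [← hl] at h1 h2
      exact ⟨false, h2, h1⟩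
  obtain ⟨σ, htσ, haσ⟩ := hhalf
  have hsub := hg.valley_subset_half hb (by rwa [hl]) haσ hV.left_mem
  by_cases hσ : σ = s l
  · subst hσ
    exact Or.inl ((phi_le_bI' hg hb htσ).trans (bI'_le_aI' hg hb hsub))
  · have hσ' : σ = !s l := Bool.eq_not.2 hσ
    subst hσ'
    rw [Bool.not_not] at hsub
    exact Or.inr ((cI'_le_bI' hg hb hsub).trans (bI'_le_phi hg hb htσ))

theorem PropA.image_subset_Ioo (hg : IsCRT g) (hb : IsEnum g b) (hA : PropA g b s) {i k : ℕ}
    (hki : g (b k) < g (b i))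
    (hsub : Icc (aI g b i) (cI g b i) ⊆ Icc (aI g b k) (cI g b k)) :
    Icc (aI' g b s i) (cI' g b s i) ⊆ Ioo (aI' g b s k) (cI' g b s k) := by
  have hne : k ≠ i := fun e => by rw [e] at hki; exact hki.false
  have hac : ∀ l, aI' g b s l ≤ cI' g b s l := fun l =>
    ((aI'_lt_bI' hg hb l).trans (bI'_lt_cI' hg hb l)).le
  obtain ⟨h1, h2⟩ := hA k i hne (image_subset hg hb hsub)
  obtain ⟨_, l, -, hl1, hl2⟩ := closure_nonempty_iff.1 ⟨_, h1 _ ⟨le_rfl, hki.le⟩⟩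
  obtain ⟨_, m, -, hm1, hm2⟩ := closure_nonempty_iff.1 ⟨_, h2 _ ⟨le_rfl, hki.le⟩⟩
  intro x hx
  constructor
  · exact (hl1 ⟨le_rfl, hac l⟩).1.trans_lt ((aI'_lt_bI' hg hb l).trans_le (hl2 hx).1)
  · exact ((hm2 hx).2.trans_lt (bI'_lt_cI' hg hb m)).trans_le (hm1 ⟨hac m, le_rfl⟩).2

theorem exists_intermediate (hg : IsCRT g) (hb : IsEnum g b) {t y z : ℝ}
    (ht : t ∈ Icc (0 : ℝ) 1) (hy : 0 ≤ y) (hyz : y < z) (hz : z ≤ g t) :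
    ∃ k, y < g (b k) ∧ g (b k) < z ∧ t ∈ Icc (aI g b k) (cI g b k) := by
  have ht' : t ∈ Ioo (0 : ℝ) 1 := by
    refine ⟨lt_of_le_of_ne ht.1 fun e => ?_, lt_of_le_of_ne ht.2 fun e => ?_⟩
    · rw [← e, hg.zero0] at hz
      linarith
    · rw [e, hg.zero1] at hz
      linarith
  obtain ⟨β, hβ, h1, h2, h3⟩ := hg.exists_valley ht' hy hyz hz
  obtain ⟨k, rfl⟩ := (hb.2 β).1 hβ
  exact ⟨k, h1, h2, h3⟩

/-- Between a level `y` and the bottom of a valley `i` there is an intermediate valley. -/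
theorem exists_intermediate_valley (hg : IsCRT g) (hb : IsEnum g b) {i : ℕ} {y : ℝ}
    (hy : 0 ≤ y) (hyi : y < g (b i)) :
    ∃ k, y < g (b k) ∧ g (b k) < g (b i) ∧ b i ∈ Icc (aI g b k) (cI g b k) ∧
      Icc (aI g b i) (cI g b i) ⊆ Icc (aI g b k) (cI g b k) := by
  have hV := hg.valley hb i
  have hbi : b i ∈ Icc (aI g b i) (cI g b i) := ⟨hV.left_lt.le, hV.lt_right.le⟩
  obtain ⟨k, h1, h2, h3⟩ := exists_intermediate hg hb (hV.subset_Icc hbi) hy hyi le_rfl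
  obtain ⟨σ, hσ⟩ := hg.mem_half hb h3 h2
  exact ⟨k, h1, h2, h3, (hg.valley_subset_half hb h2 hσ hbi).trans
    (Ioo_subset_Icc_self.trans (hg.half_subset hb _ _))⟩

theorem PropA.phi_mem_iff (hg : IsCRT g) (hb : IsEnum g b) (hA : PropA g b s) {i : ℕ} {t : ℝ}
    (ht : t ∈ Icc (0 : ℝ) 1) :
    phi g b s t ∈ Icc (aI' g b s i) (cI' g b s i) ↔ t ∈ Icc (aI g b i) (cI g b i) := by
  refine ⟨fun h => ?_, phi_mem hg hb⟩
  by_contra hti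
  have hV := hg.valley hb i
  obtain ⟨w, hw0, hw, hwlt⟩ : ∃ w ∈ Icc (0 : ℝ) 1, w ∈ uIcc t (b i) ∧ g w < g (b i) := by
    rcases lt_or_ge t (aI g b i) with h | h
    · obtain ⟨w, hw, hlt⟩ := hV.exists_left t ht.1 h
      refine ⟨w, ⟨ht.1.trans hw.1, by linarith [hw.2, hV.left_lt, hV.lt_right, hV.right_lt]⟩,
        ?_, hlt⟩
      rw [uIcc_of_le (h.trans hV.left_lt).le]
      exact ⟨hw.1, (hw.2.trans hV.left_lt).le⟩
    · have hc : cI g b i < t := by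
        by_contra! hc
        exact hti ⟨h, hc⟩
      obtain ⟨w, hw, hlt⟩ := hV.exists_right t hc ht.2
      refine ⟨w, ⟨by linarith [hw.1, hV.left_pos, hV.left_lt, hV.lt_right], hw.2.trans ht.2⟩,
        ?_, hlt⟩
      rw [uIcc_of_ge (hV.lt_right.trans hc).le]
      exact ⟨(hV.lt_right.trans hw.1).le, hw.2⟩
  obtain ⟨k, h1, h2, h3, h4⟩ := exists_intermediate_valley hg hb (hg.nonneg w hw0) hwlt
  have htk : t ∉ Icc (aI g b k) (cI g b k) := fun htk =>
    ((hg.valley hb k).le (uIcc_subset_Icc htk h3 hw)).not_gt h1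
  have h5 := hA.image_subset_Ioo hg hb h2 h4 h
  rcases phi_le_aI'_or_cI'_le_phi (s := s) hg hb ht htk with h6 | h6
  · exact h6.not_gt h5.1
  · exact h6.not_gt h5.2

theorem le_fShuffle (hg : IsCRT g) (hb : IsEnum g b) {i : ℕ} {r : ℝ}
    (hr : r ∈ Icc (aI' g b s i) (cI' g b s i)) : g (b i) ≤ fShuffle g b s r := by
  obtain ⟨M, hM⟩ := (isCompact_Icc.image_of_continuousOn hg.cont).bddAbove
  have hpos : ∀ i, b i ∈ Icc (0 : ℝ) 1 := fun i =>
    Ioo_subset_Icc_self (hb.isStrictLocalMin i).1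
  have hbdd : BddAbove (range fun i =>
      indicator (Icc (aI' g b s i) (cI' g b s i)) (fun _ => g (b i)) r) := by
    refine ⟨M, ?_⟩
    rintro _ ⟨j, rfl⟩
    have hMj : g (b j) ≤ M := hM ⟨b j, hpos j, rfl⟩
    exact indicator_apply_le' (fun _ => hMj) fun _ => (hg.nonneg _ (hpos j)).trans hMj
  have := le_ciSup hbdd i
  simp only [indicator_of_mem hr] at this
  exact this

theorem fShuffle_nonneg (hg : IsCRT g) (hb : IsEnum g b) (r : ℝ) : 0 ≤ fShuffle g b s r :=
  Real.iSup_nonneg fun i => indicator_nonneg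
    (fun _ _ => hg.nonneg _ (Ioo_subset_Icc_self (hb.isStrictLocalMin i).1)) r

theorem fShuffle_le {r y : ℝ} (hy : 0 ≤ y)
    (h : ∀ i, r ∈ Icc (aI' g b s i) (cI' g b s i) → g (b i) ≤ y) : fShuffle g b s r ≤ y :=
  ciSup_le fun i => indicator_apply_le' (h i) fun _ => hy

theorem PropA.fShuffle_phi (hg : IsCRT g) (hb : IsEnum g b) (hA : PropA g b s) {t : ℝ}
    (ht : t ∈ Icc (0 : ℝ) 1) : fShuffle g b s (phi g b s t) = g t := by
  refine le_antisymm (fShuffle_le (hg.nonneg t ht) fun i hi =>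
    (hg.valley hb i).le ((hA.phi_mem_iff hg hb ht).1 hi)) (le_of_forall_lt fun y hy => ?_)
  rcases lt_or_ge y 0 with hy0 | hy0
  · exact hy0.trans_le (fShuffle_nonneg hg hb _)
  · obtain ⟨k, h1, -, h3⟩ := exists_intermediate hg hb ht hy0 hy le_rfl
    exact h1.trans_le (le_fShuffle hg hb (phi_mem hg hb h3))

theorem PropA.fShuffle_bI' (hg : IsCRT g) (hb : IsEnum g b) (hA : PropA g b s) (k : ℕ) :
    fShuffle g b s (bI' g b s k) = g (b k) := by
  have hV := hg.valley hb k
  have hbk0 := hg.nonneg _ (Ioo_subset_Icc_self (hb.isStrictLocalMin k).1)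
  refine le_antisymm (fShuffle_le hbk0 fun i hi => ?_)
    (le_fShuffle hg hb ⟨(aI'_lt_bI' hg hb k).le, (bI'_lt_cI' hg hb k).le⟩)
  by_contra! hlt
  have hW := hg.valley hb i
  by_cases hik : b i ∈ Icc (aI g b k) (cI g b k)
  · obtain ⟨l, h1, h2, h3, h4⟩ := exists_intermediate_valley hg hb hbk0 hlt
    have hin := hA.image_subset_Ioo hg hb h2 h4 hi
    obtain ⟨σ, hσ⟩ := hg.mem_half hb hik hlt
    have hsub := hg.valley_subset_half hb h1 hσ h3
    by_cases hs : σ = s k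
    · subst hs
      exact (cI'_le_bI' hg hb hsub).not_gt hin.2
    · have hs' : σ = !s k := Bool.eq_not.2 hs
      subst hs'
      exact (bI'_le_aI' hg hb hsub).not_gt hin.1
  · have hai : aI g b i ∉ Icc (aI g b k) (cI g b k) := fun h => by
      obtain ⟨σ, hσ⟩ := hg.mem_half hb h (hlt.trans_eq hW.left_eq.symm)
      exact hik (hg.half_subset hb _ _ (Ioo_subset_Icc_self
        (hg.valley_subset_half hb hlt hσ hW.left_mem ⟨hW.left_lt.le, hW.lt_right.le⟩)))
    have hak : aI g b k ∉ Icc (aI g b i) (cI g b i) := fun h =>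
      (hlt.trans_le (hW.le h)).ne' hV.left_eq
    have h1 := mt (hA.phi_mem_iff hg hb (hW.subset_Icc hW.left_mem)).1 hai
    have h2 := mt (hA.phi_mem_iff hg hb (hV.subset_Icc hV.left_mem)).1 hak
    have h3 := aI'_lt_bI' (s := s) hg hb k
    have h4 := bI'_lt_cI' (s := s) hg hb k
    rcases le_total (aI' g b s i) (aI' g b s k) with h | h
    · exact h2 ⟨h, h3.le.trans hi.2⟩
    · exact h1 ⟨h, hi.1.trans h4.le⟩

theorem PropA.isLeast_fShuffle (hg : IsCRT g) (hb : IsEnum g b) (hA : PropA g b s) {x y p : ℝ}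
    (hx : x ∈ Icc (0 : ℝ) 1) (hy : y ∈ Icc (0 : ℝ) 1) (hp : p ∈ Icc x y)
    (hmin : ∀ v ∈ Icc x y, g p ≤ g v) :
    IsLeast (fShuffle g b s '' uIcc (phi g b s x) (phi g b s y)) (g p) := by
  have hxy : x ≤ y := hp.1.trans hp.2
  have hxm : x ∈ Icc x y := ⟨le_rfl, hxy⟩
  have hym : y ∈ Icc x y := ⟨hxy, le_rfl⟩
  have hp01 : p ∈ Icc (0 : ℝ) 1 := ⟨hx.1.trans hp.1, hp.2.trans hy.2⟩
  constructor
  · rcases (hmin x hxm).eq_or_lt with h | hpx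
    · exact ⟨_, left_mem_uIcc, by rw [hA.fShuffle_phi hg hb hx, h]⟩
    rcases (hmin y hym).eq_or_lt with h | hpy
    · exact ⟨_, right_mem_uIcc, by rw [hA.fShuffle_phi hg hb hy, h]⟩
    have hxp : x < p := lt_of_le_of_ne hp.1 fun e => by rw [e] at hpx; exact hpx.false
    have hpy' : p < y := lt_of_le_of_ne hp.2 fun e => by rw [e] at hpy; exact hpy.false
    obtain ⟨k, rfl⟩ := (hb.2 p).1 (hg.isStrictLocalMin (IsInnerLocalMin.of_Ioo hx.1 hy.2
      ⟨hxp, hpy'⟩ fun v hv => hmin v (Ioo_subset_Icc_self hv)))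
    have hV := hg.valley hb k
    refine ⟨bI' g b s k, ?_, hA.fShuffle_bI' hg hb k⟩
    have hxk : x ∈ Ioo (aI g b k) (b k) := by
      refine ⟨lt_of_not_ge fun hc => ?_, hxp⟩
      rcases hc.eq_or_lt with e | hc
      · rw [e, hV.left_eq] at hpx
        exact hpx.false
      · obtain ⟨w, hw, hlt⟩ := hV.exists_left x hx.1 hc
        exact (hmin w ⟨hw.1, (hw.2.trans hV.left_lt).le.trans hp.2⟩).not_gt hlt
    have hyk : y ∈ Ioo (b k) (cI g b k) := by
      refine ⟨hpy', lt_of_not_ge fun hc => ?_⟩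
      rcases hc.eq_or_lt with e | hc
      · rw [← e, hV.right_eq] at hpy
        exact hpy.false
      · obtain ⟨w, hw, hlt⟩ := hV.exists_right y hc hy.2
        exact (hmin w ⟨hp.1.trans (hV.lt_right.trans hw.1).le, hw.2⟩).not_gt hlt
    rw [mem_uIcc]
    cases hs : s k
    · exact Or.inr ⟨phi_le_bI' hg hb (by rw [hs]; exact hyk), bI'_le_phi hg hb (by rw [hs]; exact hxk)⟩
    · exact Or.inl ⟨phi_le_bI' hg hb (by rw [hs]; exact hxk), bI'_le_phi hg hb (by rw [hs]; exact hyk)⟩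
  · rintro _ ⟨r, hr, rfl⟩
    refine le_of_forall_lt fun z hz => ?_
    rcases lt_or_ge z 0 with hz0 | hz0
    · exact hz0.trans_le (fShuffle_nonneg hg hb _)
    obtain ⟨k, h1, h2, h3⟩ := exists_intermediate hg hb hx hz0 hz (hmin x hxm)
    have hV := hg.valley hb k
    have hyk : y ∈ Icc (aI g b k) (cI g b k) := by
      refine ⟨h3.1.trans hxy, ?_⟩
      by_contra! hc
      obtain ⟨w, hw, hlt⟩ := hV.exists_right y hc hy.2
      exact (h2.trans_le (hmin w ⟨h3.2.trans hw.1.le, hw.2⟩)).not_gt hlt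
    exact h1.trans_le (le_fShuffle hg hb
      (uIcc_subset_Icc (phi_mem hg hb h3) (phi_mem hg hb hyk) hr))

end Phi

/-- Under property (A): `g = f ∘ φ` and `φ` is an isometry between the
tree pseudo-distances of `g` and `f`. -/
theorem stmt16 (g : ℝ → ℝ) (hg : IsCRT g) (b : ℕ → ℝ) (hb : IsEnum g b) (s : ℕ → Bool)
    (hA : PropA g b s) :
    (∀ t ∈ Set.Icc (0:ℝ) 1, g t = fShuffle g b s (phi g b s t)) ∧
    (∀ x ∈ Set.Icc (0:ℝ) 1, ∀ y ∈ Set.Icc (0:ℝ) 1, x < y →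
      sInf (g '' Set.Icc x y) =
        sInf (fShuffle g b s '' Set.uIcc (phi g b s x) (phi g b s y))) := by
  refine ⟨fun t ht => (hA.fShuffle_phi hg hb ht).symm, fun x hx y hy hxy => ?_⟩
  obtain ⟨p, hp, hmin⟩ := isCompact_Icc.exists_isMinOn (nonempty_Icc.2 hxy.le)
    (hg.cont.mono (Icc_subset_Icc hx.1 hy.2))
  have hleast : IsLeast (g '' Icc x y) (g p) :=
    ⟨⟨p, hp, rfl⟩, by rintro _ ⟨v, hv, rfl⟩; exact hmin hv⟩
  rw [hleast.csInf_eq, (hA.isLeast_fShuffle hg hb hx hy hp hmin).csInf_eq]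

end
end
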